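/- For no integer n ≥ 12 divisible by 6 do there exist permutations σ₁, σ₂, σ₃ of {1,…,n} with σ₁σ₂σ₃ = 1, generating a subgroup that acts transitively on {1,…,n}, such that the full cycle type of σ₁ consists of n/2 copies of 2, the full cycle type of σ₂ consists of n/3 copies of 3, and the full cycle type of σ₃ consists of one 5, one 7, and (n−12)/6 copies of 6. (That is, the genus-1 ramification type [2^*][3^*][5,7,6^*] is not realizable in any degree.) -/

import Mathlib

/-- The full cycle type of a permutation of a finite set: the multiset of the lengths of its
cycles, where each fixed point counts as a cycle of length 1. -/
def fullCycleType {α : Type*} [Fintype α] [DecidableEq α] (σ : Equiv.Perm α) : Multiset ℕ :=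
  σ.cycleType + Multiset.replicate (Fintype.card α - σ.cycleType.sum) 1

/-- The subgroup generated by a set of permutations acts transitively. -/
def IsTransitiveSet {α : Type*} (s : Set (Equiv.Perm α)) : Prop :=
  ∀ x y : α, ∃ g ∈ Subgroup.closure s, g x = y

/-- A ramification data, given as a list of multisets of positive integers (partitions of `n`),
is realizable if there are permutations of `{1,…,n}` with product 1, generating a transitive
subgroup, whose full cycle types are the given multisets. -/
def Realizable (n : ℕ) (E : List (Multiset ℕ)) : Prop :=
  ∃ σ : List (Equiv.Perm (Fin n)),
    σ.map fullCycleType = E ∧ σ.prod = 1 ∧ IsTransitiveSet {g | g ∈ σ}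

section

open Equiv.Perm

/-- A connected map with set of darts `X`, edge involution `σ`, vertex rotation `ρ` and triangular
faces, together with a deck involution `τ` fixing no vertex and no edge. Up to `τ`, exactly one
vertex has degree 7, at most one vertex has degree 5, and all other vertices have degree 6. -/
structure DoubleMap (X : Type*) where
  σ : Equiv.Perm X
  ρ : Equiv.Perm X
  τ : Equiv.Perm X
  deg : X → ℕ
  σσ : ∀ x, σ (σ x) = x
  face : ∀ x, σ (ρ (σ (ρ (σ (ρ x))))) = x
  στ : ∀ x, σ (τ x) = τ (σ x)
  ρτ : ∀ x, ρ (τ x) = τ (ρ x)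
  ττ : ∀ x, τ (τ x) = x
  σ_ne : ∀ x, σ x ≠ x
  σ_ne_τ : ∀ x, σ x ≠ τ x
  not_sameCycle : ∀ x, ¬ ρ.SameCycle x (τ x)
  deg_mem : ∀ x, deg x = 5 ∨ deg x = 6 ∨ deg x = 7
  pow_deg : ∀ x, (ρ ^ deg x) x = x
  pow_ne : ∀ x k, 0 < k → k < deg x → (ρ ^ k) x ≠ x
  deg_ρ : ∀ x, deg (ρ x) = deg x
  deg_τ : ∀ x, deg (τ x) = deg x
  uniq : ∀ x y, deg x ≠ 6 → deg y = deg x → ρ.SameCycle x y ∨ ρ.SameCycle x (τ y)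
  seven : ∃ x, deg x = 7
  conn : ∀ A : Set X, A.Nonempty → (∀ x ∈ A, σ x ∈ A ∧ ρ x ∈ A) → A = Set.univ

namespace DoubleMap

variable {X : Type*} (S : DoubleMap X)

/-- The rotation around faces. -/
def w (x : X) : X := S.σ (S.ρ x)

lemma w_def (x : X) : S.w x = S.σ (S.ρ x) := rfl

lemma www (x : X) : S.w (S.w (S.w x)) = x := S.face x

lemma ρ_eq (x : X) : S.ρ x = S.σ (S.w x) := (S.σσ _).symm

lemma ρ_inv_eq (x : X) : S.ρ⁻¹ x = S.w (S.w (S.σ x)) := by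
  rw [Equiv.Perm.inv_eq_iff_eq, S.ρ_eq, S.www, S.σσ]

lemma five_le_deg (x : X) : 5 ≤ S.deg x := by rcases S.deg_mem x with h | h | h <;> omega

lemma ρ_ne (x : X) : S.ρ x ≠ x := S.pow_ne x 1 (by omega) (by have := S.five_le_deg x; omega)

lemma ρ_ne₂ (x : X) : S.ρ (S.ρ x) ≠ x :=
  S.pow_ne x 2 (by omega) (by have := S.five_le_deg x; omega)

lemma ρ_ne₃ (x : X) : S.ρ (S.ρ (S.ρ x)) ≠ x :=
  S.pow_ne x 3 (by omega) (by have := S.five_le_deg x; omega)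

lemma ρ_inv_τ (x : X) : S.ρ⁻¹ (S.τ x) = S.τ (S.ρ⁻¹ x) := by
  rw [Equiv.Perm.inv_eq_iff_eq, S.ρτ]; simp

/-- The same map with the opposite orientation. -/
def mirror : DoubleMap X where
  σ := S.σ
  ρ := S.ρ⁻¹
  τ := S.τ
  deg := S.deg
  σσ := S.σσ
  face x := by simp only [S.ρ_inv_eq, S.σσ, S.www]
  στ := S.στ
  ρτ := S.ρ_inv_τ
  ττ := S.ττ
  σ_ne := S.σ_ne
  σ_ne_τ := S.σ_ne_τ
  not_sameCycle x := by rw [sameCycle_inv]; exact S.not_sameCycle x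
  deg_mem := S.deg_mem
  pow_deg x := by
    rw [inv_pow, Equiv.Perm.inv_eq_iff_eq]; exact (S.pow_deg x).symm
  pow_ne x k h0 hk h := S.pow_ne x k h0 hk (by
    rw [inv_pow, Equiv.Perm.inv_eq_iff_eq] at h; exact h.symm)
  deg_ρ x := by
    have := S.deg_ρ (S.ρ⁻¹ x)
    rw [← this]; simp
  deg_τ := S.deg_τ
  uniq x y h h' := by simpa only [sameCycle_inv] using S.uniq x y h h'
  seven := S.seven
  conn A hA h := by
    refine S.conn A hA fun x hx => ⟨(h x hx).1, ?_⟩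
    have key : ∀ n : ℕ, (S.ρ⁻¹ ^ n) x ∈ A := by
      intro n
      induction n with
      | zero => simpa using hx
      | succ n ih => rw [pow_succ']; exact (h _ ih).2
    have e : (S.ρ⁻¹ ^ (S.deg x - 1)) x = S.ρ x := by
      rw [inv_pow, Equiv.Perm.inv_eq_iff_eq, ← Equiv.Perm.mul_apply, ← pow_succ,
        Nat.sub_add_cancel, S.pow_deg]
      rcases S.deg_mem x with h | h | h <;> omega
    rw [← e]; exact key _

@[simp] lemma mirror_σ : S.mirror.σ = S.σ := rfl
@[simp] lemma mirror_ρ : S.mirror.ρ = S.ρ⁻¹ := rfl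
@[simp] lemma mirror_τ : S.mirror.τ = S.τ := rfl
@[simp] lemma mirror_deg : S.mirror.deg = S.deg := rfl

/-- `S.Walk k x y`: there is a walk of `k` edges from the vertex of `x` to the vertex of `y`. -/
def Walk : ℕ → X → X → Prop
  | 0, x, y => S.ρ.SameCycle x y
  | k + 1, x, y => ∃ z, Walk k x z ∧ S.ρ.SameCycle (S.σ z) y

@[simp] lemma walk_zero {x y : X} : S.Walk 0 x y ↔ S.ρ.SameCycle x y := Iff.rfl

@[simp] lemma sameCycle_self (x : X) : S.ρ.SameCycle x x := SameCycle.refl _ _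

variable {S}

lemma Walk.congr_right {k : ℕ} {x y z : X} (h : S.Walk k x y) (hyz : S.ρ.SameCycle y z) :
    S.Walk k x z := by
  cases k with
  | zero => exact SameCycle.trans h hyz
  | succ k => obtain ⟨t, h1, h2⟩ := h; exact ⟨t, h1, h2.trans hyz⟩

lemma Walk.congr_left {k : ℕ} {x y z : X} (h : S.Walk k x y) (hxz : S.ρ.SameCycle x z) :
    S.Walk k z y := by
  induction k generalizing y with
  | zero => exact hxz.symm.trans h
  | succ k ih => obtain ⟨t, h1, h2⟩ := h; exact ⟨t, ih h1, h2⟩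

lemma Walk.trans {k l : ℕ} {x y z : X} (h : S.Walk k x y) (h' : S.Walk l y z) :
    S.Walk (k + l) x z := by
  induction l generalizing z with
  | zero => exact h.congr_right h'
  | succ l ih => obtain ⟨t, h1, h2⟩ := h'; exact ⟨t, ih h1, h2⟩

lemma sameCycle_τ {x y : X} (h : S.ρ.SameCycle x y) : S.ρ.SameCycle (S.τ x) (S.τ y) := by
  obtain ⟨i, rfl⟩ := h
  refine ⟨i, ?_⟩
  have : Commute (S.ρ ^ i) S.τ :=
    Commute.zpow_left (by ext x; simp [S.ρτ]) i
  exact DFunLike.congr_fun this.eq x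

lemma Walk.of_seq {y : ℕ → X} {n : ℕ} (hy : ∀ i < n, S.Walk 1 (y i) (y (i + 1))) :
    S.Walk n (y 0) (y n) := by
  induction n with
  | zero => exact SameCycle.refl _ _
  | succ n ih => exact (ih fun i hi => hy i (by omega)).trans (hy n (by omega))

lemma Walk.of_seq_int {y : ℤ → X} (a : ℤ) (n : ℕ)
    (hy : ∀ i, a ≤ i → i < a + n → S.Walk 1 (y i) (y (i + 1))) :
    S.Walk n (y a) (y (a + n)) := by
  have := Walk.of_seq (S := S) (y := fun i : ℕ => y (a + i)) (n := n) fun i hi => by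
    have := hy (a + i) (by omega) (by omega)
    simpa [add_assoc] using this
  simpa using this

lemma walk_mirror {k : ℕ} {x y : X} : S.mirror.Walk k x y ↔ S.Walk k x y := by
  induction k generalizing y with
  | zero => simp [walk_zero, sameCycle_inv]
  | succ k ih => simp only [Walk, ih, mirror_σ, mirror_ρ, sameCycle_inv]

variable (S)

/-- No essential closed walk is shorter than `L`. -/
def NoShort (L : ℕ) : Prop := 0 < L ∧ ∀ k < L, ∀ x, ¬ S.Walk k x (S.τ x)

variable {S}

lemma NoShort.mirror {L : ℕ} (h : S.NoShort L) : S.mirror.NoShort L :=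
  ⟨h.1, fun k hk x hw => h.2 k hk x (walk_mirror.1 hw)⟩

lemma NoShort.walk {L k : ℕ} (h : S.NoShort L) (hk : k < L) {x : X}
    (hw : S.Walk k x (S.τ x)) : False := h.2 k hk x hw

variable (S)

/-- `y` is anti-periodic with period `L` with respect to the deck involution. -/
def Anti (L : ℕ) (y : ℤ → X) : Prop := ∀ i, y (i + L) = S.τ (y i)

variable {S}

lemma Anti.sub {L : ℕ} {y : ℤ → X} (h : S.Anti L y) (i : ℤ) : y (i - L) = S.τ (y i) := by
  have := h (i - L)
  rw [sub_add_cancel] at this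
  rw [this, S.ττ]

lemma Anti.add_mul {L : ℕ} {y : ℤ → X} (h : S.Anti L y) (i q : ℤ) :
    y (i + q * L) = if Even q then y i else S.τ (y i) := by
  induction q using Int.induction_on with
  | zero => simp
  | succ n ih =>
    have e : i + ((n : ℤ) + 1) * L = i + n * L + L := by ring
    rw [e, h (i + n * L), ih]
    by_cases hn : Even (n : ℤ) <;> simp only [hn, Int.even_add_one, S.ττ, if_true, if_false,
      not_true, not_false_iff]
  | pred n ih =>
    have e : i + (-(n : ℤ) - 1) * L = i + -n * L - L := by ring
    rw [e, h.sub (i + -n * L), ih]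
    by_cases hn : Even (-(n : ℤ)) <;> simp only [hn, Int.even_sub_one, S.ττ, if_true, if_false,
      not_true, not_false_iff]

/-- Vertices of an essential closed walk of minimal length are distinct. -/
lemma NoShort.simple {L : ℕ} (hL : S.NoShort L) {y : ℤ → X} (hp : S.Anti L y)
    (hy : ∀ i, S.Walk 1 (y i) (y (i + 1))) {i j : ℤ}
    (h : S.ρ.SameCycle (y i) (y j) ∨ S.ρ.SameCycle (y i) (S.τ (y j))) : (L : ℤ) ∣ j - i := by
  have hL0 : (0 : ℤ) < L := by exact_mod_cast hL.1
  set e := (j - i) % L with he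
  set q := (j - i) / L with hq
  have hj : j = (i + e) + q * L := by
    have := Int.emod_add_mul_ediv (j - i) L
    rw [mul_comm] at this; linarith
  have he0 : 0 ≤ e := Int.emod_nonneg _ hL0.ne'
  have heL : e < L := Int.emod_lt_of_pos _ hL0
  by_contra hdiv
  have he1 : 0 < e := by
    rcases he0.lt_or_eq with h0 | h0
    · exact h0
    · exact absurd (Int.dvd_of_emod_eq_zero h0.symm) hdiv
  have h' : S.ρ.SameCycle (y i) (y (i + e)) ∨ S.ρ.SameCycle (y i) (S.τ (y (i + e))) := by
    rw [hj, hp.add_mul] at h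
    split_ifs at h
    · exact h
    · rw [S.ττ] at h; exact h.symm
  obtain ⟨n, hn⟩ := Int.eq_ofNat_of_zero_le he0
  rw [hn] at h' he1 heL
  rcases h' with h' | h'
  · have := Walk.of_seq_int (i + n) (L - n) (fun k _ _ => hy k)
    have e1 : i + (n : ℤ) + ((L - n : ℕ) : ℤ) = i + L := by omega
    rw [e1, hp] at this
    exact hL.walk (by omega) (this.congr_left h'.symm)
  · have := Walk.of_seq_int i n (fun k _ _ => hy k)
    have h2 := sameCycle_τ h'
    rw [S.ττ] at h2
    exact hL.walk (by omega) (this.congr_right h2.symm)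

lemma NoShort.simple_same {L : ℕ} (hL : S.NoShort L) {y : ℤ → X} (hp : S.Anti L y)
    (hy : ∀ i, S.Walk 1 (y i) (y (i + 1))) {i j : ℤ}
    (h : S.ρ.SameCycle (y i) (y j)) : ∃ q, Even q ∧ j = i + q * L := by
  obtain ⟨q, hq⟩ := hL.simple hp hy (Or.inl h)
  have hj : j = i + q * L := by linarith
  refine ⟨q, ?_, hj⟩
  by_contra hodd
  rw [hj, hp.add_mul, if_neg hodd] at h
  exact S.not_sameCycle _ h

end DoubleMap

namespace DoubleMap

variable {X : Type*} {S : DoubleMap X}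

/-- `e` is a sequence of darts along an essential closed walk of length `L`, turning at each vertex
by `3 - δ` steps. -/
structure Loop (S : DoubleMap X) (L : ℕ) (e : ℤ → X) (δ : ℤ → ℤ) : Prop where
  anti : S.Anti L e
  per : ∀ i, δ (i + L) = δ i
  step : ∀ i, e (i + 1) = (S.ρ ^ (δ i - 3)) (S.σ (e i))

namespace Loop

variable {L : ℕ} {e : ℤ → X} {δ : ℤ → ℤ}

lemma walk (h : S.Loop L e δ) (i : ℤ) : S.Walk 1 (e i) (e (i + 1)) :=
  ⟨e i, SameCycle.refl _ _, by rw [h.step]; simp⟩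

lemma le_one (h : S.Loop L e δ) (hL : S.NoShort L) (h3 : ∀ i, δ i ≤ 3) (i : ℤ) : δ i ≤ 1 := by
  have h0 := hL.1
  by_contra hlt
  have h2 : δ i = 2 ∨ δ i = 3 := by have := h3 i; omega
  have hs := h.step i
  have hw := h.walk (i + 1)
  rcases Nat.lt_or_ge 1 L with h1 | h1
  · have key : ∃ k < 2, S.Walk k (e i) (e (i + 1 + 1)) := by
      rcases h2 with h2 | h2
      · refine ⟨1, by omega, S.ρ (e i), by simp, ?_⟩
        rw [h2] at hs
        have e1 : S.σ (e (i + 1)) = S.ρ (S.σ (S.ρ (e i))) := by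
          rw [hs, show (S.ρ ^ ((2 : ℤ) - 3)) (S.σ (e i)) = S.ρ⁻¹ (S.σ (e i)) from rfl]
          simp only [S.ρ_eq, S.ρ_inv_eq, S.σσ]
        have h4 : S.ρ.SameCycle (S.σ (e (i + 1))) (e (i + 1 + 1)) := by
          rw [h.step (i + 1)]; simp
        rw [e1] at h4
        simpa using h4
      · refine ⟨0, by omega, ?_⟩
        rw [h2] at hs
        have h4 : S.ρ.SameCycle (S.σ (e (i + 1))) (e (i + 1 + 1)) := by
          rw [h.step (i + 1)]; simp
        rw [hs] at h4
        simpa [S.σσ] using h4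
    obtain ⟨k, hk, hk'⟩ := key
    have := Walk.of_seq_int (i + 1 + 1) (L - 2) (fun k _ _ => h.walk k)
    have e1 : i + 1 + 1 + ((L - 2 : ℕ) : ℤ) = i + L := by omega
    rw [e1, h.anti] at this
    exact hL.walk (by omega) (hk'.trans this)
  · have hL1 : L = 1 := by omega
    have h1 := h.anti i
    rw [hL1, Nat.cast_one, hs] at h1
    rcases h2 with h2 | h2
    · rw [h2] at h1
      rw [show (S.ρ ^ ((2 : ℤ) - 3)) (S.σ (e i)) = S.ρ⁻¹ (S.σ (e i)) from rfl,
        Equiv.Perm.inv_eq_iff_eq] at h1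
      have h1' : S.σ (S.ρ (S.τ (e i))) = e i := by rw [← h1, S.σσ]
      rw [S.ρτ, S.στ] at h1'
      have h5 : S.w (e i) = S.τ (e i) := by rw [w_def, ← h1', S.ττ, h1']
      have hwτ : ∀ x, S.w (S.τ x) = S.τ (S.w x) := fun x => by simp only [w_def, S.ρτ, S.στ]
      have h6 := S.www (e i)
      rw [h5, hwτ, h5, S.ττ, h5] at h6
      exact S.not_sameCycle (e i) (by rw [h6])
    · rw [h2] at h1
      exact S.σ_ne_τ _ (by simpa using h1)

end Loop

variable (S) in
/-- The translation of a dart to the parallel dart one row further to the right of it. -/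
def P (x : X) : X := S.ρ (S.ρ (S.σ (S.ρ x)))

lemma P_def (x : X) : S.P x = S.ρ (S.ρ (S.σ (S.ρ x))) := rfl

lemma P_τ (x : X) : S.P (S.τ x) = S.τ (S.P x) := by simp only [P_def, S.ρτ, S.στ]

namespace Loop

variable {L : ℕ} {e : ℤ → X} {δ : ℤ → ℤ}

lemma P_walk_zero (h : S.Loop L e δ) {j : ℤ} (hj : δ j = 0) :
    S.Walk 1 (S.P (e j)) (S.P (e (j + 1))) := by
  refine ⟨S.P (e j), SameCycle.refl _ _, ?_⟩
  have : S.P (e (j + 1)) = S.ρ (S.ρ (S.ρ (S.σ (S.P (e j))))) := by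
    rw [h.step, hj]
    have : ((S.ρ ^ ((0 : ℤ) - 3)) (S.σ (e j))) = S.ρ⁻¹ (S.ρ⁻¹ (S.ρ⁻¹ (S.σ (e j)))) := rfl
    rw [this]
    simp only [P_def, S.ρ_eq, S.ρ_inv_eq, S.σσ, S.www]
  rw [this]; simp

lemma P_of_one (h : S.Loop L e δ) {j : ℤ} (hj : δ j = 1) :
    S.P (e (j + 1)) = S.ρ (S.ρ (S.ρ (S.σ (S.ρ (e j))))) := by
  rw [h.step, hj]
  have : ((S.ρ ^ ((1 : ℤ) - 3)) (S.σ (e j))) = S.ρ⁻¹ (S.ρ⁻¹ (S.σ (e j))) := rfl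
  rw [this]
  simp only [P_def, S.ρ_eq, S.ρ_inv_eq, S.σσ, S.www]

lemma P_sameCycle_of_one (h : S.Loop L e δ) {j : ℤ} (hj : δ j = 1) :
    S.ρ.SameCycle (S.P (e j)) (S.P (e (j + 1))) := by
  rw [h.P_of_one hj, P_def]; simp

lemma P_walk_left (h : S.Loop L e δ) {j : ℤ} (hj : δ j = 1) :
    S.Walk 1 (e j) (S.P (e (j + 1))) :=
  ⟨S.ρ (e j), by simp, by rw [h.P_of_one hj]; simp⟩

lemma P_walk_right (h : S.Loop L e δ) {j : ℤ} (hj : δ j = 1) :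
    S.Walk 1 (S.P (e j)) (e (j + 1 + 1)) := by
  refine ⟨S.ρ (S.ρ (S.σ (S.ρ (e j)))), by simp [P_def], ?_⟩
  have e1 : S.σ (e (j + 1)) = S.ρ (S.σ (S.ρ (S.ρ (S.σ (S.ρ (e j)))))) := by
    rw [h.step, hj]
    have : ((S.ρ ^ ((1 : ℤ) - 3)) (S.σ (e j))) = S.ρ⁻¹ (S.ρ⁻¹ (S.σ (e j))) := rfl
    rw [this]
    simp only [S.ρ_eq, S.ρ_inv_eq, S.σσ]
  have h4 : S.ρ.SameCycle (S.σ (e (j + 1))) (e (j + 1 + 1)) := by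
    rw [h.step (j + 1)]; simp
  rw [e1] at h4
  simpa using h4

lemma no_plus_plus (h : S.Loop L e δ) (hL : S.NoShort L) {a : ℤ} {n : ℕ}
    (ha : δ a = 1) (hb : δ (a + n + 1) = 1) (hz : ∀ j, a < j → j ≤ a + n → δ j = 0) : False := by
  have h0 := hL.1
  have row := Walk.of_seq_int (S := S) (y := fun i => S.P (e i)) (a + 1) n
    (fun k h1 h2 => h.P_walk_zero (hz k (by omega) (by omega)))
  have e1 : a + 1 + (n : ℤ) = a + n + 1 := by ring
  simp only [e1] at row
  have short : ∀ {a : ℤ} {n : ℕ}, n + 3 ≤ L → δ a = 1 → δ (a + n + 1) = 1 →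
      S.Walk n (S.P (e (a + 1))) (S.P (e (a + n + 1))) → False := by
    intro a n hn ha hb row
    have w1 := ((h.P_walk_left ha).trans row).trans (h.P_walk_right hb)
    have w2 := Walk.of_seq_int (a + n + 1 + 1 + 1) (L - (n + 3)) (fun k _ _ => h.walk k)
    have e2 : a + n + 1 + 1 + 1 + ((L - (n + 3) : ℕ) : ℤ) = a + L := by omega
    rw [e2, h.anti] at w2
    exact hL.walk (by omega) (w1.trans w2)
  rcases lt_trichotomy (n + 2) L with hn | hn | hn
  · exact short hn ha hb row
  · have hb' : δ (a + n + 1 + 1) = 1 := by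
      have : a + n + 1 + 1 = a + L := by omega
      rw [this, h.per, ha]
    by_cases hn0 : n = 0
    · subst hn0
      have c1 := h.P_sameCycle_of_one ha
      have c2 := h.P_sameCycle_of_one hb
      have : a + ((0 : ℕ) : ℤ) + 1 + 1 = a + L := by omega
      rw [this, h.anti, P_τ] at c2
      refine S.not_sameCycle _ (SameCycle.trans c1 ?_)
      simpa using c2
    · refine short (a := a + n + 1) (n := 0) (by omega) hb (by simpa using hb') ?_
      simp [walk_zero]
  · have hn1 : n + 1 = L := by
      by_contra hne
      have := hz (a + L) (by omega) (by omega)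
      rw [h.per, ha] at this
      omega
    have : a + n + 1 = a + L := by omega
    rw [this, h.anti, P_τ] at row
    have c1 := h.P_sameCycle_of_one ha
    exact hL.walk (by omega) (row.congr_right (sameCycle_τ c1))

lemma sum_le_one_aux (h : S.Loop L e δ) (hL : S.NoShort L) (h3 : ∀ i, δ i ≤ 3) (a : ℤ) (n : ℕ) :
    ∑ j ∈ Finset.range n, δ (a + j) ≤ 1 ∧ (∑ j ∈ Finset.range n, δ (a + j) = 1 →
      ∃ k < n, δ (a + k) = 1 ∧ ∀ j, k < j → j < n → δ (a + j) = 0) := by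
  induction n with
  | zero => simp
  | succ n ih =>
    rw [Finset.sum_range_succ]
    have h1 := h.le_one hL h3 (a + n)
    obtain ⟨ih1, ih2⟩ := ih
    by_cases hn1 : δ (a + n) = 1
    · have : ∑ j ∈ Finset.range n, δ (a + j) ≤ 0 := by
        by_contra hne
        obtain ⟨k, hk, hk1, hk2⟩ := ih2 (by omega)
        refine h.no_plus_plus hL (a := a + k) (n := n - k - 1) hk1 ?_ ?_
        · have : a + k + ((n - k - 1 : ℕ) : ℤ) + 1 = a + n := by omega
          rw [this, hn1]
        · intro j hj1 hj2
          have := hk2 (j - a).toNat (by omega) (by omega)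
          rwa [show a + ((j - a).toNat : ℤ) = j by omega] at this
      exact ⟨by omega, fun _ => ⟨n, by omega, hn1, fun j h h' => by omega⟩⟩
    · refine ⟨by omega, fun hs => ?_⟩
      obtain ⟨k, hk, hk1, hk2⟩ := ih2 (by omega)
      refine ⟨k, by omega, hk1, fun j hj1 hj2 => ?_⟩
      rcases Nat.lt_succ_iff_lt_or_eq.1 hj2 with hj | rfl
      · exact hk2 j hj1 hj
      · omega

lemma sum_le_one (h : S.Loop L e δ) (hL : S.NoShort L) (h3 : ∀ i, δ i ≤ 3) (a : ℤ) (n : ℕ) :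
    ∑ j ∈ Finset.range n, δ (a + j) ≤ 1 := (h.sum_le_one_aux hL h3 a n).1

/-- A shortest essential closed walk does not turn to one side on average. -/
lemma sum_nonpos (h : S.Loop L e δ) (hL : S.NoShort L) (h3 : ∀ i, δ i ≤ 3) (a : ℤ) :
    ∑ j ∈ Finset.range L, δ (a + j) ≤ 0 := by
  have := h.sum_le_one hL h3 a (L + L)
  rw [Finset.sum_range_add] at this
  have e1 : ∀ j : ℕ, δ (a + ((L + j : ℕ) : ℤ)) = δ (a + j) := fun j => by
    rw [← h.per (a + j)]; congr 1; push_cast; ring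
  simp only [e1] at this
  omega

end Loop

end DoubleMap

namespace DoubleMap

variable {X : Type*} {S : DoubleMap X}

variable (S) in
/-- Go straight, leaving three edge ends on the left. -/
def F (x : X) : X := S.ρ⁻¹ (S.ρ⁻¹ (S.ρ⁻¹ (S.σ x)))

variable (S) in
/-- Go straight along the next edge on the right of the frame. -/
def G (x : X) : X := S.ρ⁻¹ (S.ρ⁻¹ (S.σ (S.ρ⁻¹ x)))

variable (S) in
/-- A step of a staircase; the letter `true` stands for `G`. -/
def E (b : Bool) (x : X) : X := if b then S.G x else S.F x

variable (S) in
/-- The sixth power of the rotation, which is trivial at vertices of degree 6. -/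
def R (x : X) : X := S.ρ (S.ρ (S.ρ (S.ρ (S.ρ (S.ρ x)))))

lemma F_def (x : X) : S.F x = S.ρ⁻¹ (S.ρ⁻¹ (S.ρ⁻¹ (S.σ x))) := rfl
lemma G_def (x : X) : S.G x = S.ρ⁻¹ (S.ρ⁻¹ (S.σ (S.ρ⁻¹ x))) := rfl
lemma R_def (x : X) : S.R x = S.ρ (S.ρ (S.ρ (S.ρ (S.ρ (S.ρ x))))) := rfl
@[simp] lemma E_true (x : X) : S.E true x = S.G x := rfl
@[simp] lemma E_false (x : X) : S.E false x = S.F x := rfl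

lemma G_τ (x : X) : S.G (S.τ x) = S.τ (S.G x) := by simp only [G_def, S.ρ_inv_τ, S.στ]

lemma sameCycle_zpow (n : ℤ) (x : X) : S.ρ.SameCycle x ((S.ρ ^ n) x) := ⟨n, rfl⟩

lemma deg_ρ_inv (x : X) : S.deg (S.ρ⁻¹ x) = S.deg x := S.mirror.deg_ρ x

lemma deg_zpow (n : ℤ) (x : X) : S.deg ((S.ρ ^ n) x) = S.deg x := by
  induction n using Int.induction_on with
  | zero => simp
  | succ n ih => rw [add_comm, zpow_add, Equiv.Perm.mul_apply, zpow_one, S.deg_ρ, ih]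
  | pred n ih =>
    rw [sub_eq_add_neg, add_comm, zpow_add, Equiv.Perm.mul_apply, zpow_neg_one, deg_ρ_inv, ih]

lemma R_eq_self {x : X} : S.R x = x ↔ S.deg x = 6 := by
  have h := S.pow_deg x
  refine ⟨fun h6 => ?_, fun h6 => by rw [h6] at h; exact h⟩
  rcases S.deg_mem x with hd | hd | hd
  · rw [hd] at h
    rw [R_def, show S.ρ (S.ρ (S.ρ (S.ρ (S.ρ x)))) = x from h] at h6
    exact absurd h6 (S.ρ_ne x)
  · exact hd
  · rw [hd] at h
    have : S.ρ (S.R x) = x := h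
    rw [h6] at this
    exact absurd this (S.ρ_ne x)

lemma deg_R (x : X) : S.deg (S.R x) = S.deg x := by simp only [R_def, S.deg_ρ]

variable (S) in
/-- A periodic staircase, straight as seen from the left. -/
structure Stair (L : ℕ) (u : ℤ → X) (s : ℤ → Bool) : Prop where
  anti : S.Anti L u
  per : ∀ i, s (i + L) = s i
  step : ∀ i, u (i + 1) = S.E (s i) (u i)

variable (S) in
/-- A periodic staircase, straight as seen from the right. -/
structure RStair (L : ℕ) (u : ℤ → X) (s : ℤ → Bool) : Prop where
  anti : S.Anti L u
  per : ∀ i, s (i + L) = s i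
  step : ∀ i, u (i + 1) = S.R (S.E (s i) (u i))

lemma Loop.mirror {L : ℕ} {e : ℤ → X} {δ : ℤ → ℤ} (h : S.Loop L e δ) :
    S.mirror.Loop L e (fun i => 6 - S.deg (e (i + 1)) - δ i) where
  anti := h.anti
  per i := by
    have : i + L + 1 = i + 1 + L := by ring
    simp only [h.per, this, h.anti (i + 1), S.deg_τ]
  step i := by
    have hd : (S.ρ ^ (S.deg (e (i + 1)) : ℤ)) (e (i + 1)) = e (i + 1) := by
      rw [zpow_natCast]; exact S.pow_deg _
    conv_lhs => rw [← hd]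
    rw [mirror_ρ, mirror_σ, inv_zpow']
    generalize S.deg (e (i + 1)) = d
    rw [h.step, ← Equiv.Perm.mul_apply, ← zpow_add]
    congr 2
    ring

lemma RStair.mirror {L : ℕ} {u : ℤ → X} {s : ℤ → Bool} (h : S.RStair L u s) :
    S.mirror.Stair L (fun i => S.ρ⁻¹ (u i)) (fun i => !s i) where
  anti i := by simp only [h.anti i, S.ρ_inv_τ, mirror_τ]
  per i := by simp only [h.per]
  step i := by
    simp only [h.step]
    cases hs : s i
    · simp only [Bool.not_false, E_true, E_false, F_def, G_def, R_def, mirror_ρ, mirror_σ, inv_inv,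
        S.ρ_eq, S.ρ_inv_eq, S.σσ, S.www]
    · simp only [Bool.not_true, E_true, E_false, F_def, G_def, R_def, mirror_ρ, mirror_σ, inv_inv,
        S.ρ_eq, S.ρ_inv_eq, S.σσ, S.www]

/-- The angle defect of a letter. -/
def lett (b : Bool) : ℤ := if b then 1 else 0

lemma lett_nonneg (b : Bool) : 0 ≤ lett b := by cases b <;> simp [lett]
lemma lett_le (b : Bool) : lett b ≤ 1 := by cases b <;> simp [lett]

lemma Stair.loop {L : ℕ} {u : ℤ → X} {s : ℤ → Bool} (h : S.Stair L u s) :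
    S.Loop L (fun i => (S.ρ ^ (- lett (s i))) (u i)) (fun i => lett (s i) - lett (s (i + 1))) where
  anti i := by
    simp only [h.per, h.anti i]
    cases s i
    · simp [lett]
    · simpa [lett] using S.ρ_inv_τ _
  per i := by
    have : i + L + 1 = i + 1 + L := by ring
    simp only [this, h.per]
  step i := by
    simp only [h.step]
    have e1 : ∀ x, S.E (s i) x = (S.ρ ^ (lett (s i) - 3)) (S.σ ((S.ρ ^ (- lett (s i))) x)) := by
      intro x; cases s i <;> rfl
    rw [e1, ← Equiv.Perm.mul_apply, ← zpow_add]
    congr 2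
    ring

lemma Stair.walk {L : ℕ} {u : ℤ → X} {s : ℤ → Bool} (h : S.Stair L u s) (i : ℤ) :
    S.Walk 1 (u i) (u (i + 1)) :=
  ((h.loop.walk i).congr_left (sameCycle_zpow _ _).symm).congr_right (sameCycle_zpow _ _).symm

lemma RStair.walk {L : ℕ} {u : ℤ → X} {s : ℤ → Bool} (h : S.RStair L u s) (i : ℤ) :
    S.Walk 1 (u i) (u (i + 1)) := by
  have := walk_mirror.1 (h.mirror.walk i)
  refine (this.congr_left ?_).congr_right ?_ <;> simp

lemma Stair.sum_deg {L : ℕ} {u : ℤ → X} {s : ℤ → Bool} (h : S.Stair L u s) (hL : S.NoShort L)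
    (a : ℤ) : ∑ j ∈ Finset.range L, (6 - S.deg (u (a + j)) : ℤ) ≤ 0 := by
  have h1 := h.loop.mirror.sum_nonpos hL.mirror (fun i => by
    have h1 := S.deg_mem ((S.ρ ^ (- lett (s (i + 1)))) (u (i + 1)))
    have h2 := lett_nonneg (s i)
    have h3 := lett_le (s (i + 1))
    omega) (a - 1)
  have e1 : ∀ j : ℕ, a - 1 + j + 1 = a + j := fun j => by ring
  simp only [deg_zpow, e1,
    Finset.sum_sub_distrib _ (fun j : ℕ => (_ : ℤ) - lett (s (a + (j : ℤ))))] at h1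
  have h2 : ∑ j ∈ Finset.range L, (lett (s (a - 1 + (j : ℤ))) - lett (s (a + (j : ℤ)))) = 0 := by
    have := Finset.sum_range_sub' (fun j : ℕ => lett (s (a - 1 + (j : ℤ)))) L
    simp only [Nat.cast_add, Nat.cast_one, ← add_assoc, e1, h.per] at this
    have e2 : ∀ j : ℕ, a - 1 + (j + 1 : ℤ) = a + j := fun j => by ring
    simpa [e2] using this
  rw [h2] at h1
  simpa using h1

lemma RStair.sum_deg {L : ℕ} {u : ℤ → X} {s : ℤ → Bool} (h : S.RStair L u s) (hL : S.NoShort L)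
    (a : ℤ) : ∑ j ∈ Finset.range L, (6 - S.deg (u (a + j)) : ℤ) ≤ 0 := by
  have := h.mirror.sum_deg hL.mirror a
  simpa only [mirror_deg, deg_ρ_inv] using this

/-- A shortest essential closed walk that is straight on average is a staircase. -/
lemma Loop.exists_stair {L : ℕ} {e : ℤ → X} {δ : ℤ → ℤ} (h : S.Loop L e δ) (hL : S.NoShort L)
    (h3 : ∀ i, δ i ≤ 3) (h0 : ∀ a, ∑ j ∈ Finset.range L, δ (a + j) = 0) :
    ∃ u s, S.Stair L u s := by
  classical
  let g : ℤ → Bool := fun i => decide (∃ n : ℕ, ∑ j ∈ Finset.range n, δ (i + j) = 1)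
  have hg : ∀ i, g i = true ↔ ∃ n : ℕ, ∑ j ∈ Finset.range n, δ (i + j) = 1 := fun i => by
    simp [g]
  have hs : ∀ i n, ∑ j ∈ Finset.range (n + 1), δ (i + j)
      = δ i + ∑ j ∈ Finset.range n, δ (i + 1 + j) := by
    intro i n
    rw [Finset.sum_range_succ', add_comm]
    simp [add_left_comm, add_comm]
  have hper : ∀ i, g (i + L) = g i := by
    intro i
    have : ∀ j : ℕ, δ (i + L + j) = δ (i + j) := fun j => by
      rw [← h.per (i + j)]; congr 1; ring
    simp only [g, this]
  have hδ : ∀ i, δ i = lett (g i) - lett (g (i + 1)) := by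
    intro i
    have hle := h.sum_le_one hL h3
    have hi := h.le_one hL h3 i
    have hpos := hL.1
    have hm1 : -1 ≤ δ i := by
      have h1 := h0 i
      rw [show L = L - 1 + 1 by omega, hs] at h1
      have h2 := hle (i + 1) (L - 1)
      omega
    have hcases : δ i = 1 ∨ δ i = 0 ∨ δ i = -1 := by omega
    rcases hcases with hd | hd | hd
    · have g1 : g i = true := (hg i).2 ⟨1, by simpa using hd⟩
      have g2 : g (i + 1) = false := by
        rw [Bool.eq_false_iff, Ne, hg]
        rintro ⟨n, hn⟩
        have := hle i (n + 1)
        rw [hs] at this; omega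
      rw [g1, g2, hd]; rfl
    · have : g i = g (i + 1) := by
        rw [Bool.eq_iff_iff, hg, hg]
        constructor
        · rintro ⟨n, hn⟩
          cases n with
          | zero => simp at hn
          | succ n => exact ⟨n, by rw [hs] at hn; omega⟩
        · rintro ⟨n, hn⟩
          exact ⟨n + 1, by rw [hs]; omega⟩
      rw [this, hd]; ring
    · have g1 : g (i + 1) = true := by
        refine (hg _).2 ⟨L - 1, ?_⟩
        have h1 := h0 i
        rw [show L = L - 1 + 1 by omega, hs] at h1
        omega
      have g2 : g i = false := by
        rw [Bool.eq_false_iff, Ne, hg]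
        rintro ⟨n, hn⟩
        cases n with
        | zero => simp at hn
        | succ n =>
          have := hle (i + 1) n
          rw [hs] at hn; omega
      rw [g1, g2, hd]; rfl
  refine ⟨fun i => (S.ρ ^ lett (g i)) (e i), g, ?_, hper, ?_⟩
  · intro i
    simp only [hper, h.anti i]
    cases g i
    · simp [lett]
    · simpa [lett] using S.ρτ _
  · intro i
    have e1 : ∀ x, S.E (g i) x = (S.ρ ^ (lett (g i) - 3)) (S.σ ((S.ρ ^ (- lett (g i))) x)) := by
      intro x; cases g i <;> rfl
    simp only [e1]
    rw [← Equiv.Perm.mul_apply (S.ρ ^ (- lett (g i))), ← zpow_add, neg_add_cancel, zpow_zero,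
      Equiv.Perm.one_apply, h.step, ← Equiv.Perm.mul_apply, ← zpow_add]
    congr 2
    rw [hδ]; ring

end DoubleMap

namespace DoubleMap

variable {X : Type*} {S : DoubleMap X}

lemma deg_pos (x : X) : 0 < S.deg x := by rcases S.deg_mem x with h | h | h <;> omega

lemma exists_pow_lt {x y : X} (h : S.ρ.SameCycle x y) : ∃ m < S.deg x, (S.ρ ^ m) x = y := by
  obtain ⟨n, rfl⟩ := h
  have hd : (0 : ℤ) < S.deg x := by exact_mod_cast deg_pos x
  have h1 : (S.ρ ^ (S.deg x : ℤ)) x = x := by rw [zpow_natCast]; exact S.pow_deg x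
  have h2 : ∀ q : ℤ, (S.ρ ^ ((S.deg x : ℤ) * q)) x = x := fun q => by
    rw [zpow_mul]; exact zpow_apply_eq_self_of_apply_eq_self h1 q
  obtain ⟨m, hm⟩ := Int.eq_ofNat_of_zero_le (Int.emod_nonneg n hd.ne')
  refine ⟨m, ?_, ?_⟩
  · have := Int.emod_lt_of_pos n hd
    omega
  · rw [← zpow_natCast, ← hm]
    conv_rhs => rw [← Int.emod_add_mul_ediv n (S.deg x), zpow_add, Equiv.Perm.mul_apply, h2]

lemma Walk.exists_seq {k : ℕ} {x y : X} (h : S.Walk k x y) : ∃ e : ℕ → X,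
    S.ρ.SameCycle x (e 0) ∧ S.ρ.SameCycle (e k) y ∧
      ∀ i < k, S.ρ.SameCycle (S.σ (e i)) (e (i + 1)) := by
  induction k generalizing y with
  | zero => exact ⟨fun _ => x, SameCycle.refl _ _, h, fun i hi => by omega⟩
  | succ k ih =>
    obtain ⟨z, h1, h2⟩ := h
    obtain ⟨e, e0, ek, he⟩ := ih h1
    refine ⟨fun i => if i < k then e i else if i = k then z else y, ?_, ?_, ?_⟩
    · rcases Nat.eq_zero_or_pos k with rfl | hk
      · simpa using e0.trans ek
      · simpa [hk] using e0
    · simp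
    · intro i hi
      rcases Nat.lt_succ_iff_lt_or_eq.1 hi with hi | rfl
      · rcases Nat.lt_or_ge (i + 1) k with hk | hk
        · simpa [hi, hk] using he i hi
        · have : i + 1 = k := by omega
          subst this
          simpa using (he i hi).trans ek
      · simpa using h2

lemma Walk.exists_loop {L : ℕ} (hL : 0 < L) {x : X} (h : S.Walk L x (S.τ x)) :
    ∃ e δ, S.Loop L e δ ∧ (∀ i, δ i ≤ 3) ∧ ∀ i, 3 ≤ S.deg (e (i + 1)) + δ i := by
  obtain ⟨e, e0, eL, he⟩ := h.exists_seq
  have hL' : (0 : ℤ) < L := by exact_mod_cast hL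
  let y : ℤ → X := fun i => (S.τ ^ (i / L)) (e (i % L).toNat)
  have hy : S.Anti L y := by
    intro i
    simp only [y, Int.add_emod_right, Int.add_ediv_of_dvd_right (dvd_refl (L : ℤ)),
      Int.ediv_self hL'.ne']
    rw [add_comm, zpow_add, Equiv.Perm.mul_apply, zpow_one]
  have hτ : ∀ (q : ℤ) {a b : X}, S.ρ.SameCycle a b →
      S.ρ.SameCycle ((S.τ ^ q) a) ((S.τ ^ q) b) := by
    intro q a b hab
    obtain ⟨n, rfl⟩ := hab
    refine ⟨n, ?_⟩
    have : Commute (S.ρ ^ n) (S.τ ^ q) :=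
      (Commute.zpow_left (by ext x; simp [S.ρτ]) n).zpow_right q
    exact DFunLike.congr_fun this.eq a
  have hστ : ∀ (q : ℤ) (a : X), S.σ ((S.τ ^ q) a) = (S.τ ^ q) (S.σ a) := by
    intro q a
    have : Commute S.σ (S.τ ^ q) := Commute.zpow_right (by ext x; simp [S.στ]) q
    exact DFunLike.congr_fun this.eq a
  have hstep : ∀ i, S.ρ.SameCycle (y (i + 1)) (S.σ (y i)) := by
    intro i
    apply SameCycle.symm
    have h1 := Int.emod_nonneg i hL'.ne'
    have h2 := Int.emod_lt_of_pos i hL'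
    have h3 := Int.emod_add_mul_ediv i L
    obtain ⟨r, hr⟩ := Int.eq_ofNat_of_zero_le h1
    by_cases hlt : i % L + 1 < L
    · have e1 : (i + 1) / L = i / L ∧ (i + 1) % L = i % L + 1 :=
        (Int.ediv_emod_unique hL').2 ⟨by linarith, by omega, by omega⟩
      simp only [y, e1.1, e1.2, hr, hστ]
      refine hτ _ ?_
      have := he r (by omega)
      simpa using this
    · have e1 : (i + 1) / L = i / L + 1 ∧ (i + 1) % L = 0 :=
        (Int.ediv_emod_unique hL').2 ⟨by rw [mul_add]; linarith, le_refl _, hL'⟩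
      have hr' : r + 1 = L := by omega
      simp only [y, e1.1, e1.2, hr, hστ]
      rw [zpow_add, Equiv.Perm.mul_apply, zpow_one]
      refine hτ _ ?_
      have := he r (by omega)
      rw [hr'] at this
      simpa using (this.trans eL).trans (sameCycle_τ e0)
  have hex : ∀ i, ∃ m : ℕ, m < S.deg (y (i + 1)) ∧ (S.ρ ^ m) (y (i + 1)) = S.σ (y i) :=
    fun i => by simpa using exists_pow_lt (hstep i)
  let m : ℤ → ℕ := fun i => sInf {m | m < S.deg (y (i + 1)) ∧ (S.ρ ^ m) (y (i + 1)) = S.σ (y i)}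
  have hm : ∀ i, m i < S.deg (y (i + 1)) ∧ (S.ρ ^ m i) (y (i + 1)) = S.σ (y i) :=
    fun i => Nat.sInf_mem (hex i)
  refine ⟨y, fun i => 3 - m i, ⟨hy, ?_, ?_⟩, ?_, ?_⟩
  · intro i
    have h1 : i + L + 1 = i + 1 + L := by ring
    have h2 : ∀ n : ℕ, (S.ρ ^ n) (S.τ (y (i + 1))) = S.τ ((S.ρ ^ n) (y (i + 1))) := by
      intro n
      have : Commute (S.ρ ^ n) S.τ := Commute.pow_left (by ext x; simp [S.ρτ]) n
      exact DFunLike.congr_fun this.eq _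
    simp only [m, h1, hy _, S.deg_τ, h2, S.στ, EmbeddingLike.apply_eq_iff_eq]
  · intro i
    have := (hm i).2
    rw [← this, ← zpow_natCast, ← Equiv.Perm.mul_apply, ← zpow_add]
    simp
  · intro i; dsimp only; omega
  · intro i
    have := (hm i).1
    dsimp only; omega

lemma Loop.sum_shift {L : ℕ} {e : ℤ → X} {δ : ℤ → ℤ} (h : S.Loop L e δ) (a : ℤ) :
    ∑ j ∈ Finset.range L, δ (a + j) = ∑ j ∈ Finset.range L, δ (0 + j) := by
  have hone : ∀ a, ∑ j ∈ Finset.range L, δ (a + 1 + j) = ∑ j ∈ Finset.range L, δ (a + j) := by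
    intro a
    have h1 := Finset.sum_range_succ (fun j : ℕ => δ (a + j)) L
    have h2 := Finset.sum_range_succ' (fun j : ℕ => δ (a + j)) L
    rw [h1, h.per a] at h2
    have e1 : ∀ j : ℕ, a + ((j + 1 : ℕ) : ℤ) = a + 1 + j := fun j => by push_cast; ring
    simp only [e1, Nat.cast_zero, add_zero] at h2
    omega
  induction a using Int.induction_on with
  | zero => rfl
  | succ n ih => rw [hone, ih]
  | pred n ih => rw [← ih, ← hone, sub_add_cancel]

/-- A shortest essential closed walk meets at most one vertex of degree 7. -/
lemma NoShort.sum_deg_ge {L : ℕ} (hL : S.NoShort L) {y : ℤ → X} (hp : S.Anti L y)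
    (hy : ∀ i, S.Walk 1 (y i) (y (i + 1))) (a : ℤ) :
    -1 ≤ ∑ j ∈ Finset.range L, (6 - S.deg (y (a + j)) : ℤ) := by
  by_cases h7 : ∃ i ∈ Finset.range L, S.deg (y (a + (i : ℤ))) = 7
  · obtain ⟨i, hi, hi7⟩ := h7
    rw [← Finset.add_sum_erase _ _ hi, hi7]
    have : 0 ≤ ∑ j ∈ (Finset.range L).erase i, (6 - S.deg (y (a + j)) : ℤ) := by
      refine Finset.sum_nonneg fun j hj => ?_
      rcases S.deg_mem (y (a + (j : ℤ))) with h | h | h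
      · omega
      · omega
      · exfalso
        obtain ⟨hne, hj⟩ := Finset.mem_erase.1 hj
        have hd := hL.simple hp hy
          (S.uniq (y (a + (j : ℤ))) (y (a + (i : ℤ))) (by omega) (by omega))
        rw [Finset.mem_range] at hi hj
        have := Int.eq_zero_of_abs_lt_dvd hd (by rw [abs_lt]; constructor <;> omega)
        omega
    push_cast
    linarith
  · push Not at h7
    refine le_trans (by norm_num) (Finset.sum_nonneg fun j hj => ?_)
    have := h7 j hj
    rcases S.deg_mem (y (a + (j : ℤ))) with h | h | h <;> omega

/-- A shortest essential closed walk is a staircase, seen from the left or from the right. -/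
lemma Walk.exists_stair {L : ℕ} (hL : S.NoShort L) {x : X} (h : S.Walk L x (S.τ x)) :
    (∃ u s, S.Stair L u s) ∨ ∃ u s, S.mirror.Stair L u s := by
  obtain ⟨e, δ, hloop, h3, hdeg⟩ := h.exists_loop hL.1
  have hm3 : ∀ i, 6 - (S.deg (e (i + 1)) : ℤ) - δ i ≤ 3 := fun i => by
    have := hdeg i; omega
  have hT := hloop.sum_nonpos hL h3 0
  have hT' := hloop.mirror.sum_nonpos hL.mirror hm3
  by_cases h0 : ∑ j ∈ Finset.range L, δ (0 + j) = 0
  · exact Or.inl (hloop.exists_stair hL h3 fun a => by rw [hloop.sum_shift, h0])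
  · refine Or.inr (hloop.mirror.exists_stair hL.mirror hm3 fun a => ?_)
    have h1 := hT' a
    rw [Finset.sum_sub_distrib, hloop.sum_shift] at h1 ⊢
    have h2 := hL.sum_deg_ge hloop.anti hloop.walk (a + 1)
    simp only [add_right_comm a 1] at h2
    omega

end DoubleMap

namespace DoubleMap

variable {X : Type*} {S : DoubleMap X} {L : ℕ} {u : ℤ → X} {s : ℤ → Bool}

lemma P_E (b : Bool) (x : X) : S.P (S.E b x) = S.R (S.E b (S.P x)) := by
  cases b <;> simp only [E_true, E_false, F_def, G_def, P_def, R_def,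
    S.ρ_eq, S.ρ_inv_eq, S.σσ, S.www]

lemma R_eq_self_of_deg {x : X} (h : S.deg (S.R x) = 6) : S.R x = x := by
  rw [deg_R] at h; exact R_eq_self.2 h

lemma P_G (x : X) : S.P (S.G x) = S.ρ (S.ρ (S.ρ (S.σ x))) := by
  simp only [G_def, P_def, S.ρ_eq, S.ρ_inv_eq, S.σσ, S.www]

lemma ρσρρ_F (x : X) : S.ρ (S.σ (S.ρ (S.ρ (S.F x)))) = S.P x := by
  simp only [F_def, P_def, S.ρ_eq, S.ρ_inv_eq, S.σσ, S.www]

lemma ρσρρ_G (x : X) : S.ρ (S.σ (S.ρ (S.ρ (S.G x)))) = x := by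
  simp only [G_def, S.ρ_eq, S.ρ_inv_eq, S.σσ, S.www]

lemma iterate_τ (k : ℕ) (x : X) : S.P^[k] (S.τ x) = S.τ (S.P^[k] x) := by
  induction k with
  | zero => rfl
  | succ k ih => rw [Function.iterate_succ_apply', ih, P_τ, ← Function.iterate_succ_apply' S.P]

lemma Stair.shift (h : S.Stair L u s) (a : ℤ) :
    S.Stair L (fun i => u (a + i)) (fun i => s (a + i)) where
  anti i := by rw [← h.anti (a + i), add_assoc]
  per i := by rw [← h.per (a + i), add_assoc]
  step i := by rw [← h.step (a + i), add_assoc]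

lemma Stair.row (h : S.Stair L u s) : S.RStair L (fun i => S.P (u i)) s where
  anti i := by simp only [h.anti i, P_τ]
  per := h.per
  step i := by simp only [h.step, P_E]

lemma RStair.stair (h : S.RStair L u s) (hf : ∀ i, S.deg (u i) = 6) : S.Stair L u s where
  anti := h.anti
  per := h.per
  step i := by
    have h1 := h.step i
    rw [R_eq_self_of_deg (by rw [← h1]; exact hf _)] at h1
    exact h1

lemma Stair.iterate (h : S.Stair L u s) {m : ℕ}
    (hf : ∀ k, 1 ≤ k → k < m → ∀ i, S.deg (S.P^[k] (u i)) = 6) {k : ℕ} (hk : k < m) :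
    S.Stair L (fun i => S.P^[k] (u i)) s := by
  induction k with
  | zero => exact h
  | succ k ih =>
    refine RStair.stair ?_ (hf (k + 1) (by omega) hk)
    simpa only [Function.iterate_succ_apply'] using (ih (by omega)).row

lemma Stair.iterate_row (h : S.Stair L u s) {m : ℕ} (hm : 1 ≤ m)
    (hf : ∀ k, 1 ≤ k → k < m → ∀ i, S.deg (S.P^[k] (u i)) = 6) :
    S.RStair L (fun i => S.P^[m] (u i)) s := by
  obtain ⟨k, rfl⟩ := Nat.exists_eq_add_of_le' hm
  simpa only [Function.iterate_succ_apply'] using (h.iterate hf (k := k) (by omega)).row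

variable (S) in
lemma P_injective : Function.Injective S.P := fun x y h => by simpa [P_def] using h

variable (S) in
lemma exists_iterate_P [Finite X] : ∃ N, 0 < N ∧ ∀ x, S.P^[N] x = x := by
  let p : Equiv.Perm X := S.ρ * S.ρ * S.σ * S.ρ
  obtain ⟨N, hN, h⟩ := (isOfFinOrder_of_finite p).exists_pow_eq_one
  refine ⟨N, hN, fun x => ?_⟩
  have : (S.P^[N]) = ⇑(p ^ N) := Equiv.Perm.iterate_eq_pow p N
  rw [this, h]; rfl

/-- Rows parallel to a staircase cannot be flat forever. -/
lemma Stair.exists_row_not_flat [Finite X] (h : S.Stair L u s) :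
    ∃ k, ∃ i, S.deg (S.P^[k + 1] (u i)) ≠ 6 := by
  by_contra hcon
  push Not at hcon
  obtain ⟨N, hN, hN'⟩ := S.exists_iterate_P
  have hflat : ∀ k i, S.deg (S.P^[k] (u i)) = 6 := by
    intro k i
    cases k with
    | succ k => exact hcon k i
    | zero =>
      rw [Function.iterate_zero_apply, ← hN' (u i), show N = N - 1 + 1 by omega]
      exact hcon _ i
  have hst : ∀ k, S.Stair L (fun i => S.P^[k] (u i)) s := fun k =>
    h.iterate (m := k + 1) (fun k _ _ i => hflat k i) (by omega)
  have hback : ∀ k i, ∃ k', S.P (S.P^[k'] (u i)) = S.P^[k] (u i) := fun k i => by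
    refine ⟨k + (N - 1), ?_⟩
    rw [← Function.iterate_succ_apply' S.P, show (k + (N - 1)).succ = k + N by omega,
      Function.iterate_add_apply, hN']
  let A : Set X := {x | ∃ k i, S.ρ.SameCycle (S.P^[k] (u i)) x}
  have hA : A = Set.univ := by
    refine S.conn A ⟨u 0, 0, 0, SameCycle.refl _ _⟩ fun x hx => ?_
    obtain ⟨k, i, hk⟩ := hx
    refine ⟨?_, k, i, by simpa using hk⟩
    obtain ⟨a, ha, rfl⟩ := exists_pow_lt hk
    rw [hflat] at ha
    have hR := R_eq_self.2 (hflat k i)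
    have hsucc := (hst k).step i
    have hpred := (hst k).step (i - 1)
    rw [sub_add_cancel] at hpred
    have hup : ∀ i, S.P (S.P^[k] (u i)) = S.P^[k + 1] (u i) := fun i =>
      (Function.iterate_succ_apply' S.P k (u i)).symm
    obtain ⟨k₁, hk₁⟩ := hback k i
    obtain ⟨k₂, hk₂⟩ := hback k (i - 1)
    have hR4 : (S.ρ ^ 4) (S.P^[k] (u i)) = S.ρ⁻¹ (S.ρ⁻¹ (S.P^[k] (u i))) := by
      conv_rhs => rw [← hR]
      simp [R_def, pow_succ]
    have hR5 : (S.ρ ^ 5) (S.P^[k] (u i)) = S.ρ⁻¹ (S.P^[k] (u i)) := by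
      conv_rhs => rw [← hR]
      simp [R_def, pow_succ]
    have hp3 : ∀ x, (S.ρ ^ 3) x = S.ρ (S.ρ (S.ρ x)) := fun x => rfl
    have hp2 : ∀ x, (S.ρ ^ 2) x = S.ρ (S.ρ x) := fun x => rfl
    interval_cases a
    · cases hs : s i
      · refine ⟨k, i + 1, ?_⟩
        rw [hsucc, hs, E_false, F_def]
        simp
      · refine ⟨k + 1, i + 1, ?_⟩
        rw [← hup, hsucc, hs, E_true, P_G]
        simp
    · refine ⟨k + 1, i, ?_⟩
      rw [← hup, P_def]
      simp
    · cases hs : s (i - 1)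
      · refine ⟨k + 1, i - 1, ?_⟩
        rw [hp2, ← hup, hpred, hs, E_false, ← ρσρρ_F]
        simp
      · refine ⟨k, i - 1, ?_⟩
        rw [hp2, hpred, hs, E_true]
        conv_lhs => rw [← ρσρρ_G (S := S) (S.P^[k] (u (i - 1)))]
        simp
    · cases hs : s (i - 1)
      · refine ⟨k, i - 1, ?_⟩
        rw [hp3, hpred, hs, E_false, F_def]
        simp [S.σσ]
      · refine ⟨k₂, i - 1, ?_⟩
        have : ∀ x, S.σ (S.ρ (S.ρ (S.ρ (S.G (S.P x))))) = x := fun x => by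
          simp only [G_def, P_def, S.ρ_eq, S.ρ_inv_eq, S.σσ, S.www]
        rw [hp3, hpred, hs, E_true, ← hk₂, this]
    · refine ⟨k₁, i, ?_⟩
      rw [hR4, ← hk₁, P_def]
      simp [S.σσ]
    · rw [hR5]
      cases hs : s i
      · obtain ⟨k₃, hk₃⟩ := hback k (i + 1)
        refine ⟨k₃, i + 1, ?_⟩
        have h3 := R_eq_self.2 (hflat k (i + 1))
        rw [← hk₃] at h3
        have e1 : S.R (S.F (S.P^[k] (u i))) = S.P (S.P^[k₃] (u (i + 1))) := by
          rw [hk₃, hsucc, hs, E_false] at h3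
          rw [h3, hk₃, hsucc, hs, E_false]
        have e2 : S.P^[k₃] (u (i + 1)) = S.ρ⁻¹ (S.ρ⁻¹ (S.σ (S.ρ⁻¹ (S.P^[k] (u i))))) := by
          apply S.P_injective
          rw [← e1]
          simp only [F_def, P_def, R_def, S.ρ_eq, S.ρ_inv_eq, S.σσ, S.www]
        rw [e2]
        simp
      · refine ⟨k, i + 1, ?_⟩
        rw [hsucc, hs, E_true, G_def]
        simp
  obtain ⟨x, hx⟩ := S.seven
  have : x ∈ A := hA ▸ Set.mem_univ x
  obtain ⟨k, i, n, hn⟩ := this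
  have h6 := hflat k i
  rw [← hn, deg_zpow] at hx
  omega

lemma exists_deg_seven {y : ℤ → X} (hy : ∀ a, ∑ j ∈ Finset.range L, (6 - S.deg (y (a + j)) : ℤ) ≤ 0)
    (hL : 0 < L) {i : ℤ} (hi : S.deg (y i) ≠ 6) : ∃ j, S.deg (y j) = 7 := by
  by_contra hcon
  push Not at hcon
  have h1 := Finset.single_le_sum (f := fun j : ℕ => (6 - S.deg (y (i + j)) : ℤ)) (fun j _ => by
    have := hcon (i + j)
    rcases S.deg_mem (y (i + j)) with h | h | h <;> omega) (Finset.mem_range.2 hL)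
  have h2 := hcon i
  have h3 := hy i
  have h4 : (6 - S.deg (y (i + ((0 : ℕ) : ℤ))) : ℤ) = 1 := by
    simp only [Nat.cast_zero, add_zero]
    rcases S.deg_mem (y i) with h | h | h <;> omega
  omega

/-- The first row on the right of a staircase that is not flat contains the vertex of degree 7. -/
lemma Stair.exists_top [Finite X] (hL : S.NoShort L) (h : S.Stair L u s) :
    ∃ m, 1 ≤ m ∧ (∀ k, 1 ≤ k → k < m → ∀ i, S.deg (S.P^[k] (u i)) = 6) ∧
      ∃ i, S.deg (S.P^[m] (u i)) = 7 := by
  classical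
  have hex := h.exists_row_not_flat
  have hmin : ∀ k, 1 ≤ k → k < Nat.find hex + 1 → ∀ i, S.deg (S.P^[k] (u i)) = 6 := by
    intro k h1 hk i
    by_contra hne
    refine Nat.find_min hex (m := k - 1) (by omega) ⟨i, ?_⟩
    rwa [Nat.sub_add_cancel h1]
  refine ⟨Nat.find hex + 1, by omega, hmin, ?_⟩
  obtain ⟨i, hi⟩ := Nat.find_spec hex
  exact exists_deg_seven ((h.iterate_row (by omega) hmin).sum_deg hL) hL.1 hi

/-- There is a staircase through the vertex of degree 7, for one of the two orientations. -/
lemma Stair.exists_seven [Finite X] (hL : S.NoShort L) (h : S.Stair L u s) :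
    (∃ u s, S.Stair L u s ∧ S.deg (u 0) = 7) ∨
      ∃ u s, S.mirror.Stair L u s ∧ S.mirror.deg (u 0) = 7 := by
  obtain ⟨m, hm, hflat, i, hi⟩ := h.exists_top hL
  refine Or.inr ⟨_, _, (h.iterate_row hm hflat).mirror.shift i, ?_⟩
  simpa only [mirror_deg, deg_ρ_inv, add_zero] using hi

end DoubleMap

namespace DoubleMap

variable {X : Type*} {S : DoubleMap X} {L : ℕ} {u : ℤ → X} {s : ℤ → Bool}

lemma emod_succ {L : ℤ} (hL : 0 < L) (i : ℤ) :
    (i + 1) % L = if i % L + 1 < L then i % L + 1 else 0 := by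
  have h1 := Int.emod_nonneg i hL.ne'
  have h2 := Int.emod_lt_of_pos i hL
  rw [Int.add_emod]
  split_ifs with h
  · by_cases hL1 : L = 1
    · omega
    · rw [Int.emod_eq_of_lt (a := 1) (by omega) (by omega), Int.emod_eq_of_lt (by omega) h]
  · have : i % L = L - 1 := by omega
    rw [this]
    by_cases hL1 : L = 1
    · subst hL1; rfl
    · rw [Int.emod_eq_of_lt (a := 1) (by omega) (by omega)]
      simp

/-- A staircase through the vertex of degree 7 does not meet its other vertices. -/
lemma Stair.deg_ne_seven (hL : S.NoShort L) (h : S.Stair L u s) (h0 : S.deg (u 0) = 7) {i : ℤ}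
    (hi : ¬ (L : ℤ) ∣ i) : S.deg (u i) ≠ 7 := fun h7 => by
  have := hL.simple h.anti h.walk (S.uniq (u 0) (u i) (by omega) (by omega))
  exact hi (by simpa using this)

lemma Stair.flat_of_turn (hL : S.NoShort L) (h : S.Stair L u s) (h0 : S.deg (u 0) = 7) {i : ℤ}
    (hi : ¬ (L : ℤ) ∣ i + 1) (h1 : s i = false) (h2 : s (i + 1) = true) :
    S.deg (u (i + 1)) = 6 := by
  have h5 := h.loop.mirror.le_one hL.mirror (fun i => by
    have h1 := S.deg_mem ((S.ρ ^ (- lett (s (i + 1)))) (u (i + 1)))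
    have h2 := lett_nonneg (s i)
    have h3 := lett_le (s (i + 1))
    omega) i
  rw [deg_zpow, h1, h2] at h5
  have h7 := h.deg_ne_seven hL h0 hi
  have e1 : lett true = 1 := rfl
  have e2 : lett false = 0 := rfl
  rw [e1, e2] at h5
  rcases S.deg_mem (u (i + 1)) with h | h | h <;> omega

lemma G_R_F (x : X) : S.G (S.R (S.F x)) = S.F (S.G x) := by
  simp only [F_def, G_def, R_def, S.ρ_eq, S.ρ_inv_eq, S.σσ, S.www]

lemma emod_of_mem {L c : ℤ} (h0 : 0 ≤ c) (hc : c < L) : c % L = c := Int.emod_eq_of_lt h0 hc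

/-- Exchanging an adjacent pair of letters. -/
lemma Stair.exists_swap (hL : S.NoShort L) (h : S.Stair L u s) (h0 : S.deg (u 0) = 7) {c : ℤ}
    (hc0 : 0 < c) (hcL : c < L) (h1 : s (c - 1) = false) (h2 : s c = true) :
    ∃ u' s', S.Stair L u' s' ∧ S.deg (u' 0) = 7 ∧ s' (c - 1) = true ∧ s' c = false ∧
      ∀ i : ℤ, 0 ≤ i → i < L → i ≠ c → i ≠ c - 1 → s' i = s i := by
  have hLpos : (0 : ℤ) < L := by omega
  have hsper : ∀ i q : ℤ, s (i + q * L) = s i := by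
    intro i q
    have : Function.Periodic s (L : ℤ) := h.per
    simpa using this.int_mul q i
  have hsmod : ∀ i, s i = s (i % L) := by
    intro i
    conv_lhs => rw [← Int.emod_add_ediv_mul i L, hsper]
  have hflat : ∀ i, i % L = c → S.deg (u i) = 6 := by
    intro i hi
    have hd : ¬ (L : ℤ) ∣ i := fun hd => by
      have := Int.emod_eq_zero_of_dvd hd; omega
    have h3 : s (i - 1) = false := by
      rw [← Int.emod_add_ediv_mul i L, hi, add_sub_right_comm, hsper, h1]
    have h4 : s (i - 1 + 1) = true := by rw [sub_add_cancel, hsmod, hi, h2]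
    have := h.flat_of_turn hL h0 (by rwa [sub_add_cancel]) h3 h4
    rwa [sub_add_cancel] at this
  refine ⟨fun i => if i % L = c then S.G (u (i - 1)) else u i,
    fun i => if i % L = c - 1 then true else if i % L = c then false else s i, ⟨?_, ?_, ?_⟩,
    ?_, ?_, ?_, ?_⟩
  · intro i
    have : i + L - 1 = i - 1 + L := by ring
    simp only [Int.add_emod_right, this, h.anti _, G_τ]
    split_ifs <;> rfl
  · intro i
    simp only [Int.add_emod_right, h.per]
  · intro i
    have hm := emod_succ hLpos i
    have hi0 := Int.emod_nonneg i hLpos.ne'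
    by_cases hi1 : i % L = c - 1
    · have : (i + 1) % L = c := by rw [hm, if_pos (by omega)]; omega
      have hne : i % L ≠ c := by omega
      simp [this, hi1]
    · have hne1 : (i + 1) % L ≠ c := by rw [hm]; split_ifs <;> omega
      by_cases hi2 : i % L = c
      · have h3 : s i = true := by rw [hsmod, hi2, h2]
        have h4 : s (i - 1) = false := by
          rw [← Int.emod_add_ediv_mul i L, hi2, add_sub_right_comm, hsper, h1]
        have h5 := h.step (i - 1)
        rw [sub_add_cancel, h4, E_false] at h5
        have h6 : S.R (S.F (u (i - 1))) = u i := by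
          rw [← h5]; exact R_eq_self.2 (hflat i hi2)
        have hcc : c ≠ c - 1 := by omega
        simp only [hne1, hi2, hcc, if_true, if_false, E_false, ← G_R_F, h6]
        rw [h.step, h3, E_true]
      · simp only [hne1, hi1, hi2, if_false, h.step]
  · simp only [Int.zero_emod, hc0.ne, if_false, h0]
  · simp only [emod_of_mem (c := c - 1) (by omega) (show c - 1 < L by omega), if_true]
  · have : c ≠ c - 1 := by omega
    simp only [emod_of_mem hc0.le hcL, this, if_true, if_false]
  · intro i hi0 hiL hi1 hi2
    simp only [emod_of_mem hi0 hiL, hi1, hi2, if_false]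

/-- The letters `G` come before the letters `F`. -/
def Sorted (L : ℕ) (s : ℤ → Bool) : Prop :=
  ∀ i j : ℤ, 0 ≤ i → i < j → j < L → s i = false → s j = false

lemma exists_adjacent (h : ¬ Sorted L s) :
    ∃ c : ℤ, 0 < c ∧ c < L ∧ s (c - 1) = false ∧ s c = true := by
  by_contra hcon
  push Not at hcon
  refine h fun i j hi hij hj hs => ?_
  obtain ⟨n, hn⟩ := Int.eq_ofNat_of_zero_le (a := j - i) (by omega)
  have hj' : j = i + n := by omega
  subst hj'
  clear hn hij
  induction n with
  | zero => simpa using hs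
  | succ n ih =>
    have h1 := ih (by omega)
    have h2 := hcon (i + (n + 1 : ℕ)) (by omega) hj
      (by rw [show i + ((n + 1 : ℕ) : ℤ) - 1 = i + n by omega]; exact h1)
    simpa using h2

lemma Stair.exists_sorted (hL : S.NoShort L) (h : S.Stair L u s) (h0 : S.deg (u 0) = 7) :
    ∃ u' s', S.Stair L u' s' ∧ S.deg (u' 0) = 7 ∧ Sorted L s' := by
  induction hM : ∑ i ∈ Finset.range L, (if s i then i else 0) using Nat.strong_induction_on
    generalizing u s with
  | _ M ih =>
    by_cases hs : Sorted L s
    · exact ⟨u, s, h, h0, hs⟩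
    · obtain ⟨c, hc0, hcL, h1, h2⟩ := exists_adjacent hs
      obtain ⟨u', s', h', h0', h1', h2', hrest⟩ := h.exists_swap hL h0 hc0 hcL h1 h2
      refine ih _ ?_ h' h0' rfl
      rw [← hM]
      obtain ⟨n, rfl⟩ := Int.eq_ofNat_of_zero_le hc0.le
      have hmem : n ∈ Finset.range L := by rw [Finset.mem_range]; omega
      have hmem' : n - 1 ∈ (Finset.range L).erase n := by
        rw [Finset.mem_erase, Finset.mem_range]; omega
      have hn1 : ((n - 1 : ℕ) : ℤ) = n - 1 := by omega
      rw [← Finset.add_sum_erase _ _ hmem, ← Finset.add_sum_erase _ _ hmem',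
        ← Finset.add_sum_erase (Finset.range L) _ hmem, ← Finset.add_sum_erase _ _ hmem', hn1,
        h1, h2, h1', h2', Finset.sum_congr rfl (g := fun i : ℕ => if s i then i else 0)]
      · simp only [if_true, Bool.false_eq_true, if_false]
        omega
      · intro i hi
        simp only [Finset.mem_erase, Finset.mem_range] at hi
        rw [hrest i (by omega) (by omega) (by omega) (by omega)]

end DoubleMap

namespace DoubleMap

variable {X : Type*} {S : DoubleMap X} {L : ℕ} {u : ℤ → X} {s : ℤ → Bool} {m : ℕ}

variable (S) in
/-- A sorted staircase through the vertex of degree 7, such that the `m`-th parallel row is the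
first one which is not flat. -/
structure Strip (L : ℕ) (u : ℤ → X) (s : ℤ → Bool) (m : ℕ) : Prop where
  hL : S.NoShort L
  stair : S.Stair L u s
  deg_zero : S.deg (u 0) = 7
  sorted : Sorted L s
  one_le : 1 ≤ m
  flat : ∀ k, 1 ≤ k → k < m → ∀ i, S.deg (S.P^[k] (u i)) = 6
  seven : ∃ i, S.deg (S.P^[m] (u i)) = 7

namespace Strip

lemma L_pos (h : S.Strip L u s m) : (0 : ℤ) < L := by exact_mod_cast h.hL.1

lemma top (h : S.Strip L u s m) : S.RStair L (fun i => S.P^[m] (u i)) s :=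
  h.stair.iterate_row h.one_le h.flat

lemma row_step (h : S.Strip L u s m) {k : ℕ} (hk : k < m) (c : ℤ) :
    S.P^[k] (u (c + 1)) = S.E (s c) (S.P^[k] (u c)) :=
  (h.stair.iterate h.flat hk).step c

lemma R_row (h : S.Strip L u s m) {k : ℕ} (h1 : 1 ≤ k) (hk : k < m) (c : ℤ) :
    S.R (S.P^[k] (u c)) = S.P^[k] (u c) := R_eq_self.2 (h.flat k h1 hk c)

lemma P_row (k : ℕ) (c : ℤ) : S.P (S.P^[k] (u c)) = S.P^[k + 1] (u c) :=
  (Function.iterate_succ_apply' S.P k (u c)).symm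

lemma s_mod (h : S.Strip L u s m) (i : ℤ) : s (i % L) = s i := by
  have hp : Function.Periodic s (L : ℤ) := h.stair.per
  conv_rhs => rw [← Int.emod_add_ediv_mul i L]
  exact (hp.int_mul _ _).symm

lemma s_zero (h : S.Strip L u s m) {i : ℤ} (hi : s i = true) : s 0 = true := by
  by_contra h0
  rw [Bool.not_eq_true] at h0
  rw [← h.s_mod] at hi
  have h1 := Int.emod_nonneg i h.L_pos.ne'
  rcases h1.lt_or_eq with h1 | h1
  · rw [h.sorted 0 (i % L) le_rfl h1 (Int.emod_lt_of_pos i h.L_pos) h0] at hi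
    simp at hi
  · rw [← h1, h0] at hi; simp at hi

lemma s_neg_one (h : S.Strip L u s m) {i : ℤ} (hi : s i = false) : s (-1) = false := by
  by_contra h0
  rw [Bool.not_eq_false, ← h.stair.per] at h0
  rw [← h.s_mod] at hi
  have h1 := Int.emod_nonneg i h.L_pos.ne'
  have h2 := Int.emod_lt_of_pos i h.L_pos
  rcases (show i % L ≤ -1 + L by omega).lt_or_eq with h3 | h3
  · rw [h.sorted (i % L) (-1 + L) h1 h3 (by omega) hi] at h0
    simp at h0
  · rw [← h3, hi] at h0; simp at h0

/-- A dart on the top row coinciding with a rotate of a dart on the top row is equal to it. -/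
lemma top_eq (h : S.Strip L u s m) {j c : ℤ}
    (hjc : S.ρ.SameCycle (S.P^[m] (u j)) (S.P^[m] (u c))) : S.P^[m] (u j) = S.P^[m] (u c) := by
  obtain ⟨q, hq, rfl⟩ := h.hL.simple_same h.top.anti h.top.walk hjc
  exact ((h.top.anti.add_mul j q).trans (if_pos hq)).symm

variable (S u m) in
/-- The `j`-th dart of the top row is a rotate by `a` of a dart on one of the first `m` rows. -/
def Trans (a j : ℤ) : Prop :=
  ∃ k c, 1 ≤ k ∧ k ≤ m ∧ S.P^[m] (u j) = (S.ρ ^ a) (S.P^[k] (u c))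

lemma Trans.lt (h : S.Strip L u s m) {a : ℤ} (ha : ∀ x, (S.ρ ^ a) x ≠ x) {j : ℤ}
    (hT : Trans S u m a j) : ∃ k c, 1 ≤ k ∧ k < m ∧ S.P^[m] (u j) = (S.ρ ^ a) (S.P^[k] (u c)) := by
  obtain ⟨k, c, h1, hk, hy⟩ := hT
  refine ⟨k, c, h1, lt_of_le_of_ne hk ?_, hy⟩
  rintro rfl
  have := h.top_eq (j := j) (c := c) (by rw [hy]; exact (sameCycle_zpow _ _).symm)
  rw [hy] at this
  exact ha _ this

lemma Trans.deg (h : S.Strip L u s m) {a : ℤ} (ha : ∀ x, (S.ρ ^ a) x ≠ x) {j : ℤ}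
    (hT : Trans S u m a j) : S.deg (S.P^[m] (u j)) = 6 := by
  obtain ⟨k, c, h1, hk, hy⟩ := hT.lt h ha
  rw [hy, deg_zpow, h.flat k h1 hk]

lemma deg_top_add (h : S.Strip L u s m) (i q : ℤ) :
    S.deg (S.P^[m] (u (i + q * L))) = S.deg (S.P^[m] (u i)) := by
  have := h.top.anti.add_mul i q
  rw [this]
  split_ifs
  · rfl
  · rw [S.deg_τ]

lemma Trans.false_of_forward (h : S.Strip L u s m) {a : ℤ} (ha : ∀ x, (S.ρ ^ a) x ≠ x)
    (hstep : ∀ j, Trans S u m a j → Trans S u m a (j + 1)) {j : ℤ} (hT : Trans S u m a j) :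
    False := by
  have hall : ∀ n : ℕ, Trans S u m a (j + n) := by
    intro n
    induction n with
    | zero => simpa using hT
    | succ n ih => have := hstep _ ih; rwa [Nat.cast_add, Nat.cast_one, ← add_assoc]
  obtain ⟨i, hi⟩ := h.seven
  have hq : j ≤ i + |j - i| * L := by
    have h1 := h.L_pos
    have h2 := le_abs_self (j - i)
    have h3 := abs_nonneg (j - i)
    nlinarith
  obtain ⟨n, hn⟩ := Int.eq_ofNat_of_zero_le (sub_nonneg.2 hq)
  have h6 := (hall n).deg h ha
  rw [← hn, add_sub_cancel, h.deg_top_add, hi] at h6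
  omega

lemma Trans.false_of_backward (h : S.Strip L u s m) {a : ℤ} (ha : ∀ x, (S.ρ ^ a) x ≠ x)
    (hstep : ∀ j, Trans S u m a j → Trans S u m a (j - 1)) {j : ℤ} (hT : Trans S u m a j) :
    False := by
  have hall : ∀ n : ℕ, Trans S u m a (j - n) := by
    intro n
    induction n with
    | zero => simpa using hT
    | succ n ih => have := hstep _ ih; rwa [Nat.cast_add, Nat.cast_one, ← sub_sub]
  obtain ⟨i, hi⟩ := h.seven
  have hq : i + (-|j - i|) * L ≤ j := by
    have h1 := h.L_pos
    have h2 := neg_abs_le (j - i)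
    have h3 := abs_nonneg (j - i)
    nlinarith
  obtain ⟨n, hn⟩ := Int.eq_ofNat_of_zero_le (sub_nonneg.2 hq)
  have h6 := (hall n).deg h ha
  rw [← hn, sub_sub_cancel, h.deg_top_add, hi] at h6
  omega

lemma R_F_row_of_true (h : S.Strip L u s m) {k : ℕ} (hk : k < m) {c : ℤ} (hc : s c = true) :
    S.R (S.F (S.P^[k] (u c))) = S.P^[k + 1] (u (c + 1)) := by
  rw [← P_row, h.row_step hk, hc, E_true, P_G]
  simp [R_def, F_def]

lemma R_F_row_of_false (h : S.Strip L u s m) {k : ℕ} (h1 : 1 ≤ k) (hk : k < m) {c : ℤ}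
    (hc : s c = false) : S.R (S.F (S.P^[k] (u c))) = S.P^[k] (u (c + 1)) := by
  have := h.R_row h1 hk (c + 1)
  rw [h.row_step hk, hc, E_false] at this
  rw [this, h.row_step hk, hc, E_false]

lemma exists_R_F_row (h : S.Strip L u s m) {k : ℕ} (h1 : 1 ≤ k) (hk : k < m) (c : ℤ) :
    ∃ k' c', 1 ≤ k' ∧ k' ≤ m ∧ S.R (S.F (S.P^[k] (u c))) = S.P^[k'] (u c') := by
  cases hc : s c
  · exact ⟨k, c + 1, h1, hk.le, h.R_F_row_of_false h1 hk hc⟩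
  · exact ⟨k + 1, c + 1, by omega, hk, h.R_F_row_of_true hk hc⟩

lemma N_row_of_false (h : S.Strip L u s m) {k : ℕ} (hk : k < m) {c : ℤ} (hc : s (c - 1) = false) :
    S.ρ (S.σ (S.ρ (S.ρ (S.P^[k] (u c))))) = S.P^[k + 1] (u (c - 1)) := by
  have := h.row_step hk (c - 1)
  rw [sub_add_cancel, hc, E_false] at this
  rw [this, ρσρρ_F, P_row]

lemma N_row_of_true (h : S.Strip L u s m) {k : ℕ} (hk : k < m) {c : ℤ} (hc : s (c - 1) = true) :
    S.ρ (S.σ (S.ρ (S.ρ (S.P^[k] (u c))))) = S.P^[k] (u (c - 1)) := by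
  have := h.row_step hk (c - 1)
  rw [sub_add_cancel, hc, E_true] at this
  rw [this, ρσρρ_G]

lemma exists_N_row (h : S.Strip L u s m) {k : ℕ} (h1 : 1 ≤ k) (hk : k < m) (c : ℤ) :
    ∃ k' c', 1 ≤ k' ∧ k' ≤ m ∧ S.ρ (S.σ (S.ρ (S.ρ (S.P^[k] (u c))))) = S.P^[k'] (u c') := by
  cases hc : s (c - 1)
  · exact ⟨k + 1, c - 1, by omega, hk, h.N_row_of_false hk hc⟩
  · exact ⟨k, c - 1, h1, hk.le, h.N_row_of_true hk hc⟩

lemma zpow_one_apply (x : X) : (S.ρ ^ (1 : ℤ)) x = S.ρ x := rfl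
lemma zpow_two_apply (x : X) : (S.ρ ^ (2 : ℤ)) x = S.ρ (S.ρ x) := rfl
lemma zpow_neg_one_apply (x : X) : (S.ρ ^ (-1 : ℤ)) x = S.ρ⁻¹ x := rfl
lemma zpow_neg_two_apply (x : X) : (S.ρ ^ (-2 : ℤ)) x = S.ρ⁻¹ (S.ρ⁻¹ x) := rfl

lemma R_F_ρ (x : X) : S.R (S.F (S.ρ x)) = S.ρ (S.P x) := by
  simp only [F_def, P_def, R_def, S.ρ_eq, S.ρ_inv_eq, S.σσ, S.www]

lemma R_G_ρ (x : X) : S.R (S.G (S.ρ x)) = S.ρ (S.R (S.F x)) := by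
  simp only [F_def, G_def, R_def, S.ρ_eq, S.ρ_inv_eq, S.σσ, S.www]

lemma R_F_ρρ (x : X) : S.R (S.F (S.ρ (S.ρ x))) = S.ρ (S.ρ (S.ρ (S.σ (S.ρ (S.ρ x))))) := by
  simp only [F_def, R_def, S.ρ_eq, S.ρ_inv_eq, S.σσ, S.www]

lemma R_G_ρρ (x : X) : S.R (S.G (S.ρ (S.ρ x))) = S.ρ (S.ρ (S.P x)) := by
  simp only [G_def, P_def, R_def, S.ρ_eq, S.ρ_inv_eq, S.σσ, S.www]

lemma trans_one (h : S.Strip L u s m) {j : ℤ} : ¬ Trans S u m 1 j := by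
  have ha : ∀ x, (S.ρ ^ (1 : ℤ)) x ≠ x := S.ρ_ne
  refine fun hT => hT.false_of_forward h ha fun j hT => ?_
  obtain ⟨k, c, h1, hk, hy⟩ := hT.lt h ha
  have hstep := h.top.step j
  rw [hy, zpow_one_apply] at hstep
  cases hs : s j
  · rw [hs, E_false, R_F_ρ, P_row] at hstep
    exact ⟨k + 1, c, by omega, hk, hstep⟩
  · rw [hs, E_true, R_G_ρ] at hstep
    obtain ⟨k', c', h1', hk', e⟩ := h.exists_R_F_row h1 hk c
    exact ⟨k', c', h1', hk', by rw [hstep, e, zpow_one_apply]⟩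

lemma trans_two (h : S.Strip L u s m) {j : ℤ} : ¬ Trans S u m 2 j := by
  have ha : ∀ x, (S.ρ ^ (2 : ℤ)) x ≠ x := S.ρ_ne₂
  refine fun hT => hT.false_of_forward h ha fun j hT => ?_
  obtain ⟨k, c, h1, hk, hy⟩ := hT.lt h ha
  have hstep := h.top.step j
  rw [hy, zpow_two_apply] at hstep
  cases hs : s j
  · rw [hs, E_false, R_F_ρρ] at hstep
    obtain ⟨k', c', h1', hk', e⟩ := h.exists_N_row h1 hk c
    exact ⟨k', c', h1', hk', by rw [hstep, e, zpow_two_apply]⟩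
  · rw [hs, E_true, R_G_ρρ, P_row] at hstep
    exact ⟨k + 1, c, by omega, hk, hstep⟩

lemma pred_of_R_F {x y : X} (h : y = S.R (S.F x)) : x = S.σ (S.ρ⁻¹ (S.ρ⁻¹ (S.ρ⁻¹ y))) := by
  rw [h]; simp only [F_def, R_def, S.ρ_eq, S.ρ_inv_eq, S.σσ, S.www]

lemma pred_of_R_G {x y : X} (h : y = S.R (S.G x)) :
    x = S.ρ (S.σ (S.ρ⁻¹ (S.ρ⁻¹ (S.ρ⁻¹ (S.ρ⁻¹ y))))) := by
  rw [h]; simp only [G_def, R_def, S.ρ_eq, S.ρ_inv_eq, S.σσ, S.www]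

lemma top_pred (h : S.Strip L u s m) (j : ℤ) :
    S.P^[m] (u j) = S.R (S.E (s (j - 1)) (S.P^[m] (u (j - 1)))) := by
  have := h.top.step (j - 1)
  rwa [sub_add_cancel] at this

lemma trans_neg_two (h : S.Strip L u s m) {j : ℤ} : ¬ Trans S u m (-2) j := by
  have ha : ∀ x, (S.ρ ^ (-2 : ℤ)) x ≠ x := S.mirror.ρ_ne₂
  refine fun hT => hT.false_of_backward h ha fun j hT => ?_
  obtain ⟨k, c, h1, hk, hy⟩ := hT.lt h ha
  have hstep := h.top_pred j
  rw [hy, zpow_neg_two_apply, ← h.R_row h1 hk c] at hstep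
  cases hs : s (j - 1)
  · rw [hs, E_false] at hstep
    refine ⟨k + 1, c, by omega, hk, (pred_of_R_F hstep).trans ?_⟩
    rw [← P_row, zpow_neg_two_apply]
    simp [P_def, R_def]
  · rw [hs, E_true] at hstep
    obtain ⟨k', c', h1', hk', e⟩ := h.exists_R_F_row h1 hk c
    refine ⟨k', c', h1', hk', (pred_of_R_G hstep).trans ?_⟩
    rw [← e, zpow_neg_two_apply]
    simp [F_def, R_def]

lemma trans_neg_one (h : S.Strip L u s m) {j : ℤ} : ¬ Trans S u m (-1) j := by
  have ha : ∀ x, (S.ρ ^ (-1 : ℤ)) x ≠ x := S.mirror.ρ_ne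
  refine fun hT => hT.false_of_backward h ha fun j hT => ?_
  obtain ⟨k, c, h1, hk, hy⟩ := hT.lt h ha
  have hstep := h.top_pred j
  rw [hy, zpow_neg_one_apply, ← h.R_row h1 hk c] at hstep
  cases hs : s (j - 1)
  · rw [hs, E_false] at hstep
    obtain ⟨k', c', h1', hk', e⟩ := h.exists_N_row h1 hk c
    refine ⟨k', c', h1', hk', (pred_of_R_F hstep).trans ?_⟩
    rw [← e, zpow_neg_one_apply]
    simp [R_def]
  · rw [hs, E_true] at hstep
    refine ⟨k + 1, c, by omega, hk, (pred_of_R_G hstep).trans ?_⟩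
    rw [← P_row, zpow_neg_one_apply]
    simp [P_def, R_def]

variable {l : ℤ}

lemma ne_ρ (h : S.Strip L u s m) (hl : S.P^[m] (u l) = S.ρ (u 0)) : False := by
  have hstep := h.top.step l
  rw [hl] at hstep
  cases hs : s l
  · rw [hs, E_false, R_F_ρ] at hstep
    exact h.trans_one ⟨1, 0, le_rfl, h.one_le, hstep⟩
  · rw [hs, E_true, R_G_ρ] at hstep
    have := h.R_F_row_of_true (k := 0) h.one_le (h.s_zero hs)
    exact h.trans_one ⟨1, _, le_rfl, h.one_le, hstep.trans (congrArg S.ρ this)⟩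

lemma ne_ρρ (h : S.Strip L u s m) (hl : S.P^[m] (u l) = S.ρ (S.ρ (u 0))) : False := by
  have hstep := h.top.step l
  rw [hl] at hstep
  cases hs : s l
  · rw [hs, E_false, R_F_ρρ] at hstep
    have := h.N_row_of_false (k := 0) (c := 0) h.one_le (h.s_neg_one hs)
    exact h.trans_two ⟨1, _, le_rfl, h.one_le, hstep.trans (congrArg (S.ρ <| S.ρ ·) this)⟩
  · rw [hs, E_true, R_G_ρρ] at hstep
    exact h.trans_two ⟨1, 0, le_rfl, h.one_le, hstep⟩

lemma ne_ρρρρ (h : S.Strip L u s m) (hl : S.P^[m] (u l) = S.ρ (S.ρ (S.ρ (S.ρ (u 0))))) :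
    False := by
  have hstep := h.top_pred l
  rw [hl] at hstep
  cases hs : s (l - 1)
  · rw [hs, E_false] at hstep
    refine h.trans_neg_two ⟨1, 0, le_rfl, h.one_le, (pred_of_R_F hstep).trans ?_⟩
    rw [zpow_neg_two_apply]
    simp [P_def]
  · rw [hs, E_true] at hstep
    have := h.R_F_row_of_true (k := 0) h.one_le (h.s_zero hs)
    refine h.trans_neg_two ⟨1, 0 + 1, le_rfl, h.one_le, (pred_of_R_G hstep).trans ?_⟩
    rw [← this, zpow_neg_two_apply]
    simp [F_def, R_def]

lemma ne_ρρρρρ (h : S.Strip L u s m)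
    (hl : S.P^[m] (u l) = S.ρ (S.ρ (S.ρ (S.ρ (S.ρ (u 0)))))) : False := by
  have hstep := h.top_pred l
  rw [hl] at hstep
  cases hs : s (l - 1)
  · rw [hs, E_false] at hstep
    have := h.N_row_of_false (k := 0) (c := 0) h.one_le (h.s_neg_one hs)
    refine h.trans_neg_one ⟨1, 0 - 1, le_rfl, h.one_le, (pred_of_R_F hstep).trans ?_⟩
    rw [← this, zpow_neg_one_apply]
    simp
  · rw [hs, E_true] at hstep
    refine h.trans_neg_one ⟨1, 0, le_rfl, h.one_le, (pred_of_R_G hstep).trans ?_⟩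
    rw [zpow_neg_one_apply]
    simp [P_def]

end Strip

end DoubleMap

namespace DoubleMap

variable {X : Type*} {S : DoubleMap X} {L : ℕ} {u : ℤ → X} {s : ℤ → Bool} {m : ℕ}

/-- The number of indices `i` with `a ≤ i < a + n` and `s i = b`. -/
def cnt (b : Bool) (s : ℤ → Bool) (a : ℤ) (n : ℕ) : ℤ :=
  ∑ j ∈ Finset.range n, if s (a + j) = b then 1 else 0

lemma cnt_zero (b : Bool) (s : ℤ → Bool) (a : ℤ) : cnt b s a 0 = 0 := rfl

lemma cnt_succ (b : Bool) (s : ℤ → Bool) (a : ℤ) (n : ℕ) :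
    cnt b s a (n + 1) = cnt b s a n + if s (a + n) = b then 1 else 0 :=
  Finset.sum_range_succ _ _

lemma cnt_add (b : Bool) (s : ℤ → Bool) (a : ℤ) (n k : ℕ) :
    cnt b s a (n + k) = cnt b s a n + cnt b s (a + n) k := by
  simp only [cnt, Finset.sum_range_add, Nat.cast_add, add_assoc]

lemma cnt_pred (b : Bool) (s : ℤ → Bool) (a : ℤ) (n : ℕ) :
    cnt b s (a - (n + 1 : ℕ)) (n + 1) = cnt b s (a - n) n + if s (a - n - 1) = b then 1 else 0 := by
  rw [add_comm n 1, cnt_add, cnt_succ, cnt_zero]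
  have e1 : a - ((1 + n : ℕ) : ℤ) + ((1 : ℕ) : ℤ) = a - n := by push_cast; ring
  have e2 : a - ((1 + n : ℕ) : ℤ) + ((0 : ℕ) : ℤ) = a - n - 1 := by push_cast; ring
  rw [e1, e2]
  ring

lemma cnt_nonneg (b : Bool) (s : ℤ → Bool) (a : ℤ) (n : ℕ) : 0 ≤ cnt b s a n :=
  Finset.sum_nonneg fun j _ => by split_ifs <;> simp

lemma cnt_true_add_false (s : ℤ → Bool) (a : ℤ) (n : ℕ) :
    cnt true s a n + cnt false s a n = n := by
  rw [cnt, cnt, ← Finset.sum_add_distrib, Finset.sum_congr rfl (g := fun _ => 1)]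
  · simp
  · intro j _
    cases s (a + j) <;> simp

lemma cnt_period {b : Bool} (hs : ∀ i, s (i + L) = s i) (a a' : ℤ) :
    cnt b s a L = cnt b s a' L := by
  have hstep : ∀ a : ℤ, cnt b s (a + 1) L = cnt b s a L := fun a => by
    have h1 := cnt_succ b s a L
    have h2 := cnt_add b s a 1 L
    rw [add_comm 1 L, h1, cnt_succ, cnt_zero, hs] at h2
    simp only [Nat.cast_one, Nat.cast_zero, add_zero, zero_add] at h2
    linarith
  have hall : ∀ a, cnt b s a L = cnt b s 0 L := fun a => by
    induction a using Int.induction_on with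
    | zero => rfl
    | succ n ih => rw [hstep, ih]
    | pred n ih => rw [← hstep, sub_add_cancel, ih]
  rw [hall, hall a']

lemma cnt_add_mul {b : Bool} (hs : ∀ i, s (i + L) = s i) (a q : ℤ) (n : ℕ) :
    cnt b s (a + q * L) n = cnt b s a n := by
  have hp : Function.Periodic s (L : ℤ) := hs
  refine Finset.sum_congr rfl fun j _ => ?_
  have e : s (a + j + q * L) = s (a + j) := hp.int_mul q _
  rw [add_right_comm, e]

lemma Sorted.cnt_le (hso : Sorted L s) (hs : ∀ i, s (i + L) = s i) (a : ℤ) {n : ℕ} (hn : n ≤ L) :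
    cnt false s 0 n ≤ cnt false s a n := by
  obtain ⟨k, rfl⟩ := Nat.exists_eq_add_of_le hn
  by_cases hall : ∀ j < n, s j = true
  · have : cnt false s 0 n = 0 := Finset.sum_eq_zero fun j hj => by
      rw [zero_add, hall j (Finset.mem_range.1 hj)]; simp
    rw [this]
    exact cnt_nonneg _ _ _ _
  · push Not at hall
    obtain ⟨j, hj, hsj⟩ := hall
    have h0 : cnt true s n k = 0 := Finset.sum_eq_zero fun i hi => by
      have hi' := Finset.mem_range.1 hi
      rw [hso j (n + i) (by omega) (by omega) (by push_cast; omega) (by simpa using hsj)]; simp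
    have h1 := cnt_add false s 0 n k
    have h2 := cnt_add false s a n k
    rw [cnt_period hs a 0] at h2
    have h3 := cnt_true_add_false s n k
    have h4 := cnt_true_add_false s (a + n) k
    have h5 := cnt_nonneg true s (a + n) k
    rw [zero_add] at h1
    linarith

lemma Sorted.cnt_true_le (hso : Sorted L s) (hs : ∀ i, s (i + L) = s i) (a : ℤ) {n : ℕ}
    (hn : n ≤ L) : cnt true s (0 - n) n ≤ cnt true s a n := by
  obtain ⟨k, rfl⟩ := Nat.exists_eq_add_of_le hn
  have h1 := cnt_add false s (0 - n) n k
  have h2 := cnt_add false s a n k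
  rw [cnt_period hs a (0 - n)] at h2
  rw [sub_add_cancel] at h1
  have h3 := cnt_true_add_false s (0 - n) n
  have h4 := cnt_true_add_false s a n
  have h5 := hso.cnt_le hs (a + n) (n := k) (by omega)
  linarith

namespace Strip

lemma ρ_pow_five {x : X} (hx : S.deg x = 5) : S.ρ (S.ρ (S.ρ (S.ρ (S.ρ x)))) = x := by
  have := S.pow_deg x
  rwa [hx] at this

/-- If two darts of the top row coincide, then the letters following them are the same up to
order. -/
lemma cnt_eq_of_top_eq (h : S.Strip L u s m) (b : Bool) {i l : ℤ}
    (e : S.P^[m] (u (l + i)) = S.P^[m] (u i)) (n : ℕ) : cnt b s (l + i) n = cnt b s i n := by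
  obtain ⟨q, -, hq⟩ := h.hL.simple_same h.top.anti h.top.walk
    (show S.ρ.SameCycle (S.P^[m] (u i)) (S.P^[m] (u (l + i))) by rw [e])
  rw [hq, cnt_add_mul h.stair.per]

variable {l : ℤ}

lemma deg_cases (h : S.Strip L u s m) {i : ℤ} (h0 : i ≠ 0) (hi : |i| < L) :
    S.deg (u i) = 5 ∨ S.deg (u i) = 6 := by
  have := h.stair.deg_ne_seven h.hL h.deg_zero fun hd => h0 (Int.eq_zero_of_abs_lt_dvd hd hi)
  rcases S.deg_mem (u i) with hd | hd | hd
  exacts [Or.inl hd, Or.inr hd, absurd hd this]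

lemma R_F_eq (x : X) : S.R (S.F x) = S.ρ (S.ρ (S.ρ (S.σ x))) := by simp [R_def, F_def]

lemma ne_self_step (h : S.Strip L u s m) {n k : ℕ} {k' : ℕ} (hkm : k < m)
    (hy : S.P^[m] (u (l + n)) = S.P^[k] (u n))
    (hk' : (k' : ℤ) = k + (if s (l + n) = false then 1 else 0) - if s n = false then 1 else 0) :
    (k' = k + 1 ∧ S.P^[m] (u (l + n + 1)) = S.P^[k'] (u (n + 1))) ∨
      (k' ≤ k ∧ S.P^[m] (u (l + n + 1)) = S.R (S.P^[k'] (u (n + 1)))) := by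
  have hstep := h.top.step (l + n)
  have hrow := h.row_step hkm n
  rw [hy] at hstep
  cases hs' : s (l + n) <;> cases hs : s n <;>
    simp only [hs, hs', E_true, E_false, if_true, if_false, reduceCtorEq] at hk' hstep hrow
  · obtain rfl : k' = k := by omega
    exact Or.inr ⟨le_rfl, by rw [hstep, hrow]⟩
  · obtain rfl : k' = k + 1 := by omega
    exact Or.inl ⟨rfl, by rw [hstep, h.R_F_row_of_true hkm hs]⟩
  · obtain rfl : k = k' + 1 := by omega
    refine Or.inr ⟨by omega, ?_⟩
    rw [hstep, h.row_step (by omega), hs, E_false, ← P_row, ← E_true, ← P_E, E_true, P_G, R_F_eq]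
  · obtain rfl : k' = k := by omega
    exact Or.inr ⟨le_rfl, by rw [hstep, hrow]⟩

lemma ne_self_aux (h : S.Strip L u s m) (hl : S.P^[m] (u l) = u 0) (n : ℕ) (hn : n < L) :
    ∃ k : ℕ, (k : ℤ) = cnt false s l n - cnt false s 0 n ∧ k < m ∧
      S.P^[m] (u (l + n)) = S.P^[k] (u n) := by
  induction n with
  | zero => exact ⟨0, by simp [cnt_zero], h.one_le, by simpa using hl⟩
  | succ n ih =>
    obtain ⟨k, hk, hkm, hy⟩ := ih (by omega)
    obtain ⟨k', hk'⟩ := Int.eq_ofNat_of_zero_le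
      (sub_nonneg.2 (h.sorted.cnt_le h.stair.per l hn.le))
    refine ⟨k', hk'.symm, ?_⟩
    have e : l + ((n + 1 : ℕ) : ℤ) = l + n + 1 := by push_cast; ring
    rw [e]
    push_cast
    have hks : (k' : ℤ) = k + (if s (l + n) = false then 1 else 0) -
        if s n = false then 1 else 0 := by
      rw [← hk', hk, cnt_succ, cnt_succ, zero_add]
      ring
    rcases h.ne_self_step hkm hy hks with ⟨rfl, hy'⟩ | ⟨hk'k, hy'⟩
    · refine ⟨lt_of_le_of_ne hkm fun hm => ?_, hy'⟩
      have h1 := h.cnt_eq_of_top_eq false (i := n + 1) (l := l)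
        (by rw [← add_assoc, hy', hm]) (L - (n + 1))
      have h2 := cnt_add false s l (n + 1) (L - (n + 1))
      have h3 := cnt_add false s 0 (n + 1) (L - (n + 1))
      rw [Nat.add_sub_cancel' hn.le] at h2 h3
      rw [cnt_period h.stair.per l 0, h3] at h2
      push_cast at h2 hk'
      rw [zero_add] at h2
      omega
    · refine ⟨by omega, hy'.trans ?_⟩
      rcases Nat.eq_zero_or_pos k' with rfl | hpos
      · rw [Function.iterate_zero_apply, R_eq_self]
        rw [Function.iterate_zero_apply] at hy'
        rcases h.deg_cases (i := n + 1) (by omega) (by rw [abs_lt]; omega) with hd | hd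
        · exfalso
          have hy5 : S.P^[m] (u (l + n + 1)) = S.ρ (u (n + 1)) := by
            rw [hy', R_def, ρ_pow_five hd]
          have hst := h.top.step (l + n + 1)
          rw [hy5] at hst
          cases hs' : s (l + n + 1)
          · rw [hs', E_false, R_F_ρ] at hst
            exact h.trans_one ⟨1, _, le_rfl, h.one_le, hst⟩
          · rw [hs', E_true, R_G_ρ] at hst
            cases hs : s (n + 1)
            · have hle := h.sorted.cnt_le h.stair.per l (n := n + 1 + 1) hn
              rw [cnt_succ false s l, cnt_succ, e, zero_add] at hle
              push_cast at hle
              rw [hs, hs'] at hle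
              simp at hle hk'
              omega
            · have := h.R_F_row_of_true (k := 0) h.one_le hs
              exact h.trans_one ⟨1, _, le_rfl, h.one_le, hst.trans (congrArg S.ρ this)⟩
        · exact hd
      · exact h.R_row hpos (by omega) _

lemma ne_self (h : S.Strip L u s m) (hl : S.P^[m] (u l) = u 0) : False := by
  have hL := h.hL.1
  obtain ⟨k, hk, hkm, hy⟩ := h.ne_self_aux hl (L - 1) (by omega)
  have h1 := cnt_succ false s l (L - 1)
  have h2 := cnt_succ false s 0 (L - 1)
  rw [Nat.sub_add_cancel hL] at h1 h2
  rw [cnt_period h.stair.per l 0, h2] at h1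
  rw [zero_add] at h1
  have hks : ((0 : ℕ) : ℤ) = k + (if s (l + (L - 1 : ℕ)) = false then 1 else 0) -
      if s (L - 1 : ℕ) = false then 1 else 0 := by
    push_cast; omega
  rcases h.ne_self_step hkm hy hks with ⟨h0, -⟩ | ⟨-, hy'⟩
  · omega
  · have e1 : l + ((L - 1 : ℕ) : ℤ) + 1 = l + L := by omega
    have e2 : ((L - 1 : ℕ) : ℤ) + 1 = 0 + L := by omega
    have e3 := h.top.anti l
    have e4 := h.stair.anti 0
    beta_reduce at e3
    rw [e1, e2, e3, hl, Function.iterate_zero_apply, e4, eq_comm, R_eq_self, S.deg_τ,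
      h.deg_zero] at hy'
    omega

lemma F_injective : Function.Injective S.F := fun x y h => by simpa [F_def] using h
lemma G_injective : Function.Injective S.G := fun x y h => by simpa [G_def] using h
lemma R_injective : Function.Injective S.R := fun x y h => by simpa [R_def] using h

lemma ne_R_step (h : S.Strip L u s m) {n k : ℕ} {k' : ℕ} (hkm : k < m)
    (hy : S.P^[m] (u (l - n)) = S.R (S.P^[k] (u (0 - n))))
    (hk' : (k' : ℤ) = k + (if s (l - n - 1) = true then 1 else 0) -
      if s (0 - n - 1) = true then 1 else 0) :
    S.P^[m] (u (l - n - 1)) = S.P^[k'] (u (0 - n - 1)) := by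
  have hstep := h.top_pred (l - n)
  have hrow := h.row_step hkm (0 - n - 1)
  rw [sub_add_cancel] at hrow
  rw [hy, hrow] at hstep
  replace hstep := R_injective hstep
  cases hs' : s (l - n - 1) <;> cases hs : s (0 - n - 1) <;>
    simp only [hs, hs', E_true, E_false, if_true, if_false, reduceCtorEq] at hk' hstep
  · obtain rfl : k' = k := by omega
    exact (F_injective hstep).symm
  · obtain rfl : k = k' + 1 := by omega
    have := ρσρρ_G (S := S) (S.P^[k' + 1] (u (0 - n - 1)))
    rw [hstep, ρσρρ_F, ← P_row] at this
    exact S.P_injective this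
  · obtain rfl : k' = k + 1 := by omega
    have := ρσρρ_F (S := S) (S.P^[k] (u (0 - n - 1)))
    rwa [hstep, ρσρρ_G, P_row] at this
  · obtain rfl : k' = k := by omega
    exact (G_injective hstep).symm

lemma ne_R_aux (h : S.Strip L u s m) (hl : S.P^[m] (u l) = S.R (u 0)) (n : ℕ) (hn : n < L) :
    ∃ k : ℕ, (k : ℤ) = cnt true s (l - n) n - cnt true s (0 - n) n ∧ k < m ∧
      S.P^[m] (u (l - n)) = S.R (S.P^[k] (u (0 - n))) := by
  induction n with
  | zero => exact ⟨0, by simp [cnt_zero], h.one_le, by simpa using hl⟩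
  | succ n ih =>
    obtain ⟨k, hk, hkm, hy⟩ := ih (by omega)
    obtain ⟨k', hk'⟩ := Int.eq_ofNat_of_zero_le
      (sub_nonneg.2 (h.sorted.cnt_true_le h.stair.per (l - (n + 1 : ℕ)) hn.le))
    refine ⟨k', hk'.symm, ?_⟩
    have e : l - ((n + 1 : ℕ) : ℤ) = l - n - 1 := by push_cast; ring
    have e' : 0 - ((n + 1 : ℕ) : ℤ) = 0 - n - 1 := by push_cast; ring
    have hks : (k' : ℤ) = k + (if s (l - n - 1) = true then 1 else 0) -
        if s (0 - n - 1) = true then 1 else 0 := by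
      rw [← hk', hk, cnt_pred, cnt_pred]
      ring
    have hy' := h.ne_R_step hkm hy hks
    have hkm' : k' < m := by
      refine lt_of_le_of_ne ?_ fun hm => ?_
      · split_ifs at hks <;> omega
      · rw [hm] at hy'
        have h1 := h.cnt_eq_of_top_eq true (i := 0 - n - 1) (l := l)
          (by rw [← hy']; congr 2; ring) (n + 1)
        rw [e, e'] at hk'
        rw [show l + (0 - n - 1) = l - n - 1 by ring] at h1
        have := h.one_le
        omega
    rw [e, e']
    refine ⟨hkm', hy'.trans ?_⟩
    rcases Nat.eq_zero_or_pos k' with rfl | hpos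
    · rw [Function.iterate_zero_apply] at hy' ⊢
      rw [eq_comm, R_eq_self]
      rcases h.deg_cases (i := 0 - n - 1) (by omega) (by rw [abs_lt]; omega) with hd | hd
      · exfalso
        have hst := h.top_pred (l - n - 1)
        cases hs' : s (l - n - 1 - 1)
        · rw [hs', E_false, hy'] at hst
          have hst' := pred_of_R_F hst
          have e5 : S.ρ⁻¹ (S.ρ⁻¹ (S.ρ⁻¹ (u (0 - n - 1)))) = S.ρ (S.ρ (u (0 - n - 1))) := by
            conv_lhs => rw [← ρ_pow_five hd]
            simp
          rw [e5] at hst'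
          cases hs : s (0 - n - 1 - 1)
          · have := h.N_row_of_false (k := 0) (c := 0 - n - 1) h.one_le hs
            refine h.trans_neg_one ⟨1, 0 - n - 1 - 1, le_rfl, h.one_le, hst'.trans ?_⟩
            rw [← this, zpow_neg_one_apply]
            simp
          · have hle := h.sorted.cnt_true_le h.stair.per (l - (n + 1 + 1 : ℕ)) hn
            rw [cnt_pred true s 0 (n + 1), cnt_pred true s l (n + 1), e, e', hs, hs'] at hle
            rw [e, e'] at hk'
            simp at hle hk'
            omega
        · rw [hs', E_true, hy'] at hst
          have hst' := pred_of_R_G hst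
          refine h.trans_neg_one ⟨1, 0 - n - 1, le_rfl, h.one_le, hst'.trans ?_⟩
          have e5 : S.ρ⁻¹ (S.ρ⁻¹ (S.ρ⁻¹ (S.ρ⁻¹ (u (0 - n - 1))))) = S.ρ (u (0 - n - 1)) := by
            conv_lhs => rw [← ρ_pow_five hd]
            simp
          rw [e5, zpow_neg_one_apply]
          simp [P_def]
      · exact hd
    · exact (h.R_row hpos hkm' _).symm

lemma ne_R (h : S.Strip L u s m) (hl : S.P^[m] (u l) = S.R (u 0)) : False := by
  have hL := h.hL.1
  obtain ⟨k, hk, hkm, hy⟩ := h.ne_R_aux hl (L - 1) (by omega)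
  have h1 := cnt_pred true s l (L - 1)
  have h2 := cnt_pred true s 0 (L - 1)
  rw [Nat.sub_add_cancel hL] at h1 h2
  rw [cnt_period h.stair.per _ (0 - (L : ℤ)), h2] at h1
  have hks : ((0 : ℕ) : ℤ) = k + (if s (l - (L - 1 : ℕ) - 1) = true then 1 else 0) -
      if s (0 - (L - 1 : ℕ) - 1) = true then 1 else 0 := by
    push_cast; omega
  have hy' := h.ne_R_step hkm hy hks
  have e1 : l - ((L - 1 : ℕ) : ℤ) - 1 = l - L := by omega
  have e2 : 0 - ((L - 1 : ℕ) : ℤ) - 1 = 0 - L := by omega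
  have e3 := h.top.anti.sub l
  have e4 := h.stair.anti.sub 0
  beta_reduce at e3
  rw [e1, e2, e3, hl, Function.iterate_zero_apply, e4, S.τ.injective.eq_iff, R_eq_self,
    h.deg_zero] at hy'
  omega

end Strip

end DoubleMap

namespace DoubleMap

variable {X : Type*} {S : DoubleMap X} {L : ℕ} {u : ℤ → X} {s : ℤ → Bool} {m : ℕ}

namespace Strip

variable {l : ℤ}

lemma R_F_ρρρ (x : X) : S.R (S.F (S.ρ (S.ρ (S.ρ x)))) =
    S.ρ (S.ρ (S.ρ (S.σ (S.ρ (S.ρ (S.ρ x)))))) := R_F_eq _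

lemma R_G_ρρρ (x : X) : S.R (S.G (S.ρ (S.ρ (S.ρ x)))) =
    S.ρ (S.ρ (S.ρ (S.ρ (S.σ (S.ρ (S.ρ x)))))) := by simp [R_def, G_def]

lemma σρρρ_F (x : X) : S.σ (S.ρ (S.ρ (S.ρ (S.F x)))) = x := by simp [F_def, S.σσ]

/-- A staircase and the top row that are related by a half turn stay so. -/
lemma half_turn (h : S.Strip L u s m) (hl : S.P^[m] (u l) = S.ρ (S.ρ (S.ρ (u 0)))) (n : ℕ)
    (hn : n ≤ L) :
    ∃ k : ℕ, (k : ℤ) = cnt true s l n - cnt true s (0 - n) n ∧ k < m ∧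
      S.P^[m] (u (l + n)) = S.ρ (S.ρ (S.ρ (S.P^[k] (u (0 - n))))) := by
  induction n with
  | zero => exact ⟨0, by simp [cnt_zero], h.one_le, by simpa using hl⟩
  | succ n ih =>
    obtain ⟨k, hk, hkm, hy⟩ := ih (by omega)
    obtain ⟨k', hk'⟩ := Int.eq_ofNat_of_zero_le
      (sub_nonneg.2 (h.sorted.cnt_true_le h.stair.per l hn))
    refine ⟨k', hk'.symm, ?_⟩
    have e : l + ((n + 1 : ℕ) : ℤ) = l + n + 1 := by push_cast; ring
    have e' : 0 - ((n + 1 : ℕ) : ℤ) = 0 - n - 1 := by push_cast; ring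
    have hks : (k' : ℤ) = k + (if s (l + n) = true then 1 else 0) -
        if s (0 - n - 1) = true then 1 else 0 := by
      rw [← hk', hk, cnt_succ, cnt_pred]
      ring
    have hstep := h.top.step (l + n)
    have hrow := h.row_step hkm (0 - n - 1)
    rw [sub_add_cancel] at hrow
    rw [hy, hrow] at hstep
    rw [e, e']
    suffices hy' : S.P^[m] (u (l + n + 1)) = S.ρ (S.ρ (S.ρ (S.P^[k'] (u (0 - n - 1))))) by
      refine ⟨lt_of_le_of_ne ?_ ?_, hy'⟩
      · split_ifs at hks <;> omega
      · rintro rfl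
        have := h.top_eq (j := l + n + 1) (c := 0 - n - 1) (by
          rw [hy']; exact (sameCycle_zpow 3 _).symm)
        rw [hy'] at this
        exact S.ρ_ne₃ _ this
    cases hs' : s (l + n) <;> cases hs : s (0 - n - 1) <;>
      simp only [hs, hs', E_true, E_false, if_true, if_false, reduceCtorEq] at hks hstep
    · obtain rfl : k' = k := by omega
      rw [hstep, R_F_ρρρ, σρρρ_F]
    · obtain rfl : k = k' + 1 := by omega
      have hR := h.R_row (by omega) hkm (0 - n)
      have hP : S.R (S.G (S.P (S.P^[k'] (u (0 - n - 1))))) =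
          S.R (S.F (S.P^[k'] (u (0 - n - 1)))) := by
        rw [← E_true, ← P_E, E_true, P_G, R_F_eq]
      rw [hstep, R_F_ρρρ, ← P_row, R_injective hP, σρρρ_F]
    · obtain rfl : k' = k + 1 := by omega
      rw [hstep, R_G_ρρρ, ρσρρ_F, P_row]
    · obtain rfl : k' = k := by omega
      rw [hstep, R_G_ρρρ, ρσρρ_G]

lemma half_turn_rows (h : S.Strip L u s m) {i j : ℤ} {k : ℕ}
    (hy : S.P^[m] (u i) = S.ρ (S.ρ (S.ρ (S.P^[k] (u j))))) (n : ℕ) (hn : k + n < m) :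
    S.P^[m - n] (u i) = S.ρ (S.ρ (S.ρ (S.P^[k + n] (u j)))) := by
  induction n with
  | zero => exact hy
  | succ n ih =>
    have ih := ih (by omega)
    apply S.P_injective
    rw [P_row, show m - (n + 1) + 1 = m - n by omega, ih, ← add_assoc, ← P_row]
    have hR := h.R_row (k := k + n + 1) (by omega) (by omega) j
    rw [← P_row] at hR
    generalize S.P^[k + n] (u j) = f at hR
    have hz : S.R (S.σ (S.ρ f)) = S.σ (S.ρ f) := by simpa [R_def, P_def] using hR
    have e : S.P (S.ρ (S.ρ (S.ρ (S.P f)))) = S.ρ (S.ρ (S.σ (S.R (S.σ (S.ρ f))))) := rfl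
    rw [e, hz, S.σσ]

lemma no_half_turn (h : S.Strip L u s m) {T : X → X} (hσ : ∀ x, S.σ (T x) = T (S.σ x))
    (hρ : ∀ x, S.ρ (T x) = T (S.ρ x)) (hTT : ∀ x, T (T x) = x)
    (h1 : ∀ x, S.σ x ≠ T x) (h2 : ∀ x, S.ρ (S.ρ (S.ρ x)) ≠ T x) {k : ℕ} (hk : k < m) (j : ℤ) :
    S.P^[k + 1] (u j) ≠ S.ρ (S.ρ (S.ρ (T (S.P^[k] (u j))))) ∧
    S.P^[k + 1] (u (j + 1)) ≠ S.ρ (S.ρ (S.ρ (T (S.P^[k] (u j))))) ∧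
    (1 ≤ k → S.P^[k] (u j) ≠ S.ρ (S.ρ (S.ρ (T (S.P^[k] (u j))))) ∧
      S.P^[k] (u (j + 1)) ≠ S.ρ (S.ρ (S.ρ (T (S.P^[k] (u j)))))) := by
  have hrow := h.row_step hk j
  rw [← P_row, ← P_row, hrow]
  generalize hf : S.P^[k] (u j) = f
  refine ⟨fun e => ?_, fun e => ?_, fun hk1 => ?_⟩
  · simp only [P_def, EmbeddingLike.apply_eq_iff_eq] at e
    rw [hρ] at e
    exact h1 _ e
  · cases hs : s j
    · obtain ⟨d, rfl⟩ : ∃ d, f = S.σ (S.ρ d) := ⟨S.ρ⁻¹ (S.σ f), by simp [S.σσ]⟩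
      have e1 : S.P (S.F (S.σ (S.ρ d))) = S.ρ (S.ρ (S.σ (S.ρ⁻¹ d))) := by
        simp only [F_def, P_def, S.ρ_eq, S.ρ_inv_eq, S.σσ, S.www]
      have e2 : S.ρ (S.σ (S.ρ (T d))) = S.σ (S.ρ⁻¹ (S.σ (T d))) := by
        simp only [S.ρ_eq, S.ρ_inv_eq, S.σσ]
      rw [hs, E_false, e1, ← hσ, ← hρ, e2] at e
      simp only [EmbeddingLike.apply_eq_iff_eq] at e
      exact h1 d (by rw [e, S.σσ, ← e])
    · rw [hs, E_true, P_G] at e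
      simp only [EmbeddingLike.apply_eq_iff_eq] at e
      exact h1 _ e
  · have hR := h.R_row hk1 hk j
    rw [hf] at hR
    refine ⟨fun e => h2 f ?_, fun e => ?_⟩
    · rw [hρ, hρ, hρ] at e
      rw [e, hTT, ← e]
    · have hRT : ∀ x, S.R (T x) = T (S.R x) := fun x => by simp only [R_def, hρ]
      cases hs : s j
      · rw [hs, E_false] at e
        have := congrArg (S.ρ <| S.ρ <| S.ρ ·) e
        refine h1 f ?_
        rw [← hR, ← hRT, hR]
        simpa [F_def, R_def] using this
      · rw [hs, E_true] at e
        have := congrArg (S.ρ <| S.ρ ·) e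
        refine h1 (S.ρ⁻¹ f) ?_
        have hx : S.R (S.ρ⁻¹ f) = S.ρ⁻¹ f := by
          apply S.ρ.injective
          simpa [R_def] using hR
        rw [← hx, ← hRT, hx]
        have hT : S.ρ (T (S.ρ⁻¹ f)) = T f := by rw [hρ]; simp
        rw [← hT] at this
        simpa [G_def, R_def] using this

lemma ne_ρρρ (h : S.Strip L u s m) (hl : S.P^[m] (u l) = S.ρ (S.ρ (S.ρ (u 0)))) : False := by
  have hL := h.L_pos
  obtain ⟨n, ε, M, hn, hε, hM⟩ : ∃ (n : ℕ) (ε M : ℤ), n ≤ L ∧ (ε = 0 ∨ ε = 1) ∧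
      l + n = 0 - n + ε + M * L := by
    have h1 := Int.emod_nonneg (-l) hL.ne'
    have h2 := Int.emod_lt_of_pos (-l) hL
    have h3 := Int.emod_add_mul_ediv (-l) L
    refine ⟨((-l % L + 1) / 2).toNat, (-l % L) % 2, - (-l / L), by omega, by omega, ?_⟩
    rw [Int.toNat_of_nonneg (by omega)]
    have : -(-l / (L : ℤ)) * L = - (L * (-l / L)) := by ring
    omega
  obtain ⟨k, -, hkm, hy⟩ := h.half_turn hl n hn
  have hrows := h.half_turn_rows hy ((m - k) / 2) (by omega)
  rw [hM, h.stair.anti.add_mul] at hrows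
  have key : ∀ T : X → X, (∀ x, S.σ (T x) = T (S.σ x)) → (∀ x, S.ρ (T x) = T (S.ρ x)) →
      (∀ x, T (T x) = x) → (∀ x, S.σ x ≠ T x) → (∀ x, S.ρ (S.ρ (S.ρ x)) ≠ T x) →
      S.P^[m - (m - k) / 2] (u (0 - n + ε)) ≠
        S.ρ (S.ρ (S.ρ (T (S.P^[k + (m - k) / 2] (u (0 - n)))))) := by
    intro T a1 a2 a3 a4 a5
    obtain ⟨b1, b2, b3⟩ := h.no_half_turn a1 a2 a3 a4 a5 (k := k + (m - k) / 2) (by omega) (0 - n)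
    rcases Nat.mod_two_eq_zero_or_one (m - k) with hp | hp
    · obtain ⟨b3, b4⟩ := b3 (by omega)
      rw [show m - (m - k) / 2 = k + (m - k) / 2 by omega]
      rcases hε with rfl | rfl
      · rwa [add_zero]
      · exact b4
    · rw [show m - (m - k) / 2 = k + (m - k) / 2 + 1 by omega]
      rcases hε with rfl | rfl
      · rwa [add_zero]
      · exact b2
  split_ifs at hrows
  · exact key id (fun _ => rfl) (fun _ => rfl) (fun _ => rfl) S.σ_ne S.ρ_ne₃ hrows
  · refine key S.τ S.στ S.ρτ S.ττ S.σ_ne_τ (fun x hx => ?_) ?_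
    · exact S.not_sameCycle x (hx ▸ sameCycle_zpow 3 x)
    · rw [S.ρτ, S.ρτ, S.ρτ, ← hrows, iterate_τ, S.ττ]

end Strip

end DoubleMap

namespace DoubleMap

variable {X : Type*} {S : DoubleMap X} {L : ℕ} {u : ℤ → X} {s : ℤ → Bool} {m : ℕ}

lemma Strip.false (h : S.Strip L u s m) : False := by
  obtain ⟨i, hi⟩ := h.seven
  obtain ⟨l, hl⟩ : ∃ l, S.ρ.SameCycle (u 0) (S.P^[m] (u l)) := by
    rcases S.uniq (u 0) (S.P^[m] (u i)) (by rw [h.deg_zero]; omega) (by rw [hi, h.deg_zero])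
      with hc | hc
    · exact ⟨i, hc⟩
    · exact ⟨i + L, by have := h.top.anti i; beta_reduce at this; rwa [this]⟩
  obtain ⟨t, ht, hl⟩ := exists_pow_lt hl
  rw [h.deg_zero] at ht
  interval_cases t
  exacts [h.ne_self hl.symm, h.ne_ρ hl.symm, h.ne_ρρ hl.symm, h.ne_ρρρ hl.symm,
    h.ne_ρρρρ hl.symm, h.ne_ρρρρρ hl.symm, h.ne_R hl.symm]

lemma Stair.false [Finite X] (hL : S.NoShort L) (h : S.Stair L u s) (h0 : S.deg (u 0) = 7) :
    False := by
  obtain ⟨u', s', h', h0', hs'⟩ := h.exists_sorted hL h0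
  obtain ⟨m, hm, hf, h7⟩ := h'.exists_top hL
  exact Strip.false ⟨hL, h', h0', hs', hm, hf, h7⟩

variable (S) in
lemma exists_walk (x y : X) : ∃ k, S.Walk k x y := by
  have : {z | ∃ k, S.Walk k x z} = Set.univ := by
    refine S.conn _ ⟨x, 0, SameCycle.refl _ _⟩ ?_
    rintro z ⟨k, hz⟩
    exact ⟨⟨k + 1, z, hz, SameCycle.refl _ _⟩, k, hz.congr_right (sameCycle_zpow 1 z)⟩
  exact Set.eq_univ_iff_forall.1 this y

/-- There is no such double map. -/
theorem isEmpty [Finite X] : IsEmpty (DoubleMap X) := by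
  classical
  refine ⟨fun S => ?_⟩
  obtain ⟨x₀, -⟩ := S.seven
  have hex : ∃ k, ∃ x, S.Walk k x (S.τ x) := by
    obtain ⟨k, hk⟩ := S.exists_walk x₀ (S.τ x₀)
    exact ⟨k, x₀, hk⟩
  obtain ⟨x, hx⟩ := Nat.find_spec hex
  have hmin : ∀ k < Nat.find hex, ∀ x, ¬ S.Walk k x (S.τ x) := fun k hk x hw =>
    Nat.find_min hex hk ⟨x, hw⟩
  generalize Nat.find hex = L at hx hmin
  have hL : S.NoShort L := by
    refine ⟨Nat.pos_of_ne_zero ?_, hmin⟩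
    rintro rfl
    exact S.not_sameCycle x hx
  have key : ∀ {S : DoubleMap X}, S.NoShort L → (∃ u s, S.Stair L u s) → False := by
    rintro S hL ⟨u, s, h⟩
    rcases h.exists_seven hL with ⟨u, s, h, h0⟩ | ⟨u, s, h, h0⟩
    · exact h.false hL h0
    · exact h.false hL.mirror h0
  rcases hx.exists_stair hL with h | h
  · exact key hL h
  · exact key hL.mirror h

end DoubleMap

section Cocycle

variable {α : Type*}

/-- Functions modulo 2 that are invariant under `f`. -/
def invariants (f : α → α) : Submodule (ZMod 2) (α → ZMod 2) :=
  LinearMap.ker (LinearMap.funLeft (ZMod 2) (ZMod 2) f + LinearMap.id)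

lemma mem_invariants {f : α → α} {g : α → ZMod 2} : g ∈ invariants f ↔ ∀ x, g (f x) = g x := by
  rw [invariants, LinearMap.mem_ker, funext_iff]
  refine forall_congr' fun x => ?_
  exact CharTwo.add_eq_zero

lemma card_le_two_mul_finrank_invariants [Fintype α] {f : α → α} (hf : ∀ x, f (f x) = x) :
    Fintype.card α ≤ 2 * Module.finrank (ZMod 2) (invariants f) := by
  have h1 := LinearMap.finrank_range_add_finrank_ker
    (LinearMap.funLeft (ZMod 2) (ZMod 2) f + LinearMap.id)
  rw [Module.finrank_fintype_fun_eq_card] at h1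
  have h2 : LinearMap.range (LinearMap.funLeft (ZMod 2) (ZMod 2) f + LinearMap.id) ≤
      invariants f := by
    rintro _ ⟨g, rfl⟩
    rw [mem_invariants]
    intro x
    change g (f (f x)) + g (f x) = g (f x) + g x
    rw [hf, add_comm]
  have h3 := Submodule.finrank_mono h2
  rw [invariants] at h3 ⊢
  omega

lemma finrank_invariants_le [Fintype α] [DecidableEq α] {f : Equiv.Perm α} (hf : ∀ x, f x ≠ x) :
    Module.finrank (ZMod 2) (invariants f) ≤ f.cycleType.card := by
  have hne : ∀ c : f.cycleFactorsFinset, (c : Equiv.Perm α).support.Nonempty := fun c =>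
    (mem_cycleFactorsFinset_iff.1 c.2).1.nonempty_support
  choose r hr using hne
  have hinj : Function.Injective
      ((LinearMap.funLeft (ZMod 2) (ZMod 2) r).domRestrict (invariants f)) := by
    rw [injective_iff_map_eq_zero]
    rintro ⟨g, hg⟩ h0
    rw [Subtype.ext_iff]
    funext x
    have hx : f.cycleOf x ∈ f.cycleFactorsFinset :=
      cycleOf_mem_cycleFactorsFinset_iff.2 (mem_support.2 (hf x))
    obtain ⟨n, hn⟩ := (mem_support_cycleOf_iff.1 (hr ⟨_, hx⟩)).1
    have h1 : g (r ⟨_, hx⟩) = 0 := congrFun h0 ⟨_, hx⟩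
    have h2 : ∀ n : ℤ, g ((f ^ n) x) = g x := fun n => by
      induction n using Int.induction_on with
      | zero => rfl
      | succ n ih =>
        rw [add_comm, zpow_add, Equiv.Perm.mul_apply, zpow_one, mem_invariants.1 hg, ih]
      | pred n ih =>
        rw [sub_eq_add_neg, add_comm, zpow_add, Equiv.Perm.mul_apply, zpow_neg_one, ← ih,
          ← mem_invariants.1 hg]
        simp
    rw [← hn, h2] at h1
    exact h1
  have := LinearMap.finrank_le_finrank_of_injective hinj
  rw [Module.finrank_fintype_fun_eq_card, Fintype.card_coe] at this
  rw [cycleType_def, Multiset.card_map]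
  exact this

/-- A triangulated closed orientable surface whose Euler characteristic is at most zero carries a
cocycle modulo 2 that is not a coboundary. -/
lemma exists_cocycle [Fintype α] [DecidableEq α] {σ ρ φ : Equiv.Perm α} (hσ : ∀ x, σ (σ x) = x)
    (hφ : ∀ x, φ (φ (φ x)) = x) (hφ' : ∀ x, φ x ≠ x) (hρ' : ∀ x, ρ x ≠ x) [Nonempty α]
    (hcard : 2 * φ.cycleType.card + 2 * ρ.cycleType.card ≤ Fintype.card α) :
    ∃ c : α → ZMod 2, (∀ x, c (σ x) = c x) ∧
      (∀ x, c (ρ x) + c (ρ (φ x)) + c (ρ (φ (φ x))) = 0) ∧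
      ¬ ∃ f : α → ZMod 2, (∀ x, f (ρ x) = f x) ∧ ∀ x, f (σ x) = f x + c x := by
  let T : (α → ZMod 2) →ₗ[ZMod 2] α → ZMod 2 :=
    LinearMap.funLeft (ZMod 2) (ZMod 2) σ + LinearMap.id
  let Φ : (α → ZMod 2) →ₗ[ZMod 2] α → ZMod 2 :=
    LinearMap.funLeft (ZMod 2) (ZMod 2) ρ + LinearMap.funLeft (ZMod 2) (ZMod 2) (fun x => ρ (φ x)) +
      LinearMap.funLeft (ZMod 2) (ZMod 2) (fun x => ρ (φ (φ x)))
  by_contra! hcon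
  have hA := card_le_two_mul_finrank_invariants hσ
  have hW := finrank_invariants_le hφ'
  have hV := finrank_invariants_le hρ'
  have h1 := LinearMap.finrank_range_add_finrank_ker (Φ.domRestrict (invariants σ))
  have h2 := LinearMap.finrank_range_add_finrank_ker (T.domRestrict (invariants ρ))
  have h3 : LinearMap.range (Φ.domRestrict (invariants σ)) ≤ invariants φ := by
    rintro _ ⟨g, rfl⟩
    rw [mem_invariants]
    intro x
    change g.1 (ρ (φ x)) + g.1 (ρ (φ (φ x))) + g.1 (ρ (φ (φ (φ x)))) =
      g.1 (ρ x) + g.1 (ρ (φ x)) + g.1 (ρ (φ (φ x)))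
    rw [hφ]
    ring
  have h4 : (LinearMap.ker (Φ.domRestrict (invariants σ))).map (invariants σ).subtype ≤
      LinearMap.range (T.domRestrict (invariants ρ)) := by
    rintro _ ⟨c, hc, rfl⟩
    obtain ⟨f, hf, hf'⟩ := hcon c.1 (mem_invariants.1 c.2) (congrFun hc)
    refine ⟨⟨f, mem_invariants.2 hf⟩, ?_⟩
    funext x
    change f (σ x) + f x = c.1 x
    rw [hf', add_right_comm, CharTwo.add_self_eq_zero, zero_add]
  have h5 := Submodule.finrank_mono h3
  have h6 := Submodule.finrank_mono h4
  rw [Submodule.finrank_map_subtype_eq] at h6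
  have h7 : 0 < Module.finrank (ZMod 2) (LinearMap.ker (T.domRestrict (invariants ρ))) := by
    rw [Module.finrank_pos_iff_exists_ne_zero]
    refine ⟨⟨⟨1, mem_invariants.2 fun _ => rfl⟩, ?_⟩, ?_⟩
    · funext x
      exact CharTwo.add_self_eq_zero (1 : ZMod 2)
    · intro h
      obtain ⟨x⟩ := ‹Nonempty α›
      have := congrFun (congrArg (fun z => z.1.1) h) x
      exact one_ne_zero this
  omega

end Cocycle

section DoubleCover

variable {α : Type*}

lemma Equiv.Perm.inv_apply_mem [Finite α] (f : Equiv.Perm α) {B : Set α} (h : ∀ x ∈ B, f x ∈ B)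
    {x : α} (hx : x ∈ B) : f⁻¹ x ∈ B := by
  obtain ⟨n, hn, hf⟩ := (isOfFinOrder_of_finite f).exists_pow_eq_one
  have e : f⁻¹ = f ^ (n - 1) := by
    rw [inv_eq_iff_mul_eq_one, ← pow_succ', Nat.sub_add_cancel hn, hf]
  rw [e]
  generalize n - 1 = k
  induction k with
  | zero => exact hx
  | succ k ih => rw [pow_succ']; exact h _ ih

/-- Rotation of darts, lifted to the double cover. -/
def liftRotation (ρ : Equiv.Perm α) : Equiv.Perm (α × ZMod 2) :=
  Equiv.prodCongr ρ (Equiv.refl _)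

lemma liftRotation_zpow (ρ : Equiv.Perm α) (n : ℤ) (x : α × ZMod 2) :
    (liftRotation ρ ^ n) x = ((ρ ^ n) x.1, x.2) := by
  induction n using Int.induction_on with
  | zero => rfl
  | succ n ih =>
    rw [add_comm, zpow_add, Equiv.Perm.mul_apply, zpow_one, ih, zpow_add, Equiv.Perm.mul_apply,
      zpow_one]
    rfl
  | pred n ih =>
    rw [sub_eq_add_neg, add_comm, zpow_add, Equiv.Perm.mul_apply, zpow_neg_one, ih, zpow_add,
      Equiv.Perm.mul_apply, zpow_neg_one]
    rfl

lemma liftRotation_pow (ρ : Equiv.Perm α) (n : ℕ) (x : α × ZMod 2) :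
    (liftRotation ρ ^ n) x = ((ρ ^ n) x.1, x.2) := by
  simpa only [zpow_natCast] using liftRotation_zpow ρ n x

lemma sameCycle_liftRotation {ρ : Equiv.Perm α} {x y : α × ZMod 2} :
    (liftRotation ρ).SameCycle x y ↔ ρ.SameCycle x.1 y.1 ∧ x.2 = y.2 := by
  simp only [Equiv.Perm.SameCycle, liftRotation_zpow, Prod.ext_iff]
  exact ⟨fun ⟨n, h1, h2⟩ => ⟨⟨n, h1⟩, h2⟩, fun ⟨⟨n, h1⟩, h2⟩ => ⟨n, h1, h2⟩⟩

/-- The flip of edges, lifted to the double cover given by a cochain. -/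
def liftFlip (σ : Equiv.Perm α) (hσ : ∀ x, σ (σ x) = x) (c : α → ZMod 2)
    (hc : ∀ x, c (σ x) = c x) : Equiv.Perm (α × ZMod 2) :=
  Function.Involutive.toPerm (fun x => (σ x.1, x.2 + c x.1)) fun x => by
    simp [hσ, hc, add_assoc, CharTwo.add_self_eq_zero]

/-- The double cover is connected if the cocycle is not a coboundary. -/
lemma doubleCover_connected {σ ρ : Equiv.Perm α} {c : α → ZMod 2}
    (htr : ∀ B : Set α, B.Nonempty → (∀ x ∈ B, σ x ∈ B ∧ ρ x ∈ B) → B = Set.univ)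
    (hc : ¬ ∃ f : α → ZMod 2, (∀ x, f (ρ x) = f x) ∧ ∀ x, f (σ x) = f x + c x)
    {A : Set (α × ZMod 2)} (hA : A.Nonempty)
    (h : ∀ x ∈ A, (σ x.1, x.2 + c x.1) ∈ A ∧ (ρ x.1, x.2) ∈ A) : A = Set.univ := by
  have h1 : {d | ∃ t, (d, t) ∈ A} = Set.univ := by
    obtain ⟨x, hx⟩ := hA
    refine htr _ ⟨x.1, x.2, hx⟩ ?_
    rintro d ⟨t, ht⟩
    exact ⟨⟨_, (h _ ht).1⟩, _, (h _ ht).2⟩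
  rw [Set.eq_univ_iff_forall] at h1
  choose f hf using h1
  by_cases hex : ∃ d, ∃ t, t ≠ f d ∧ (d, t) ∈ A
  · have h2 : {d | ∀ t, (d, t) ∈ A} = Set.univ := by
      refine htr _ ?_ fun d hd => ⟨fun t => ?_, fun t => (h _ (hd t)).2⟩
      · obtain ⟨d, t, htf, hA⟩ := hex
        refine ⟨d, fun t' => ?_⟩
        by_cases ht' : t' = t
        · rwa [ht']
        · have : t' = f d := by
            have h3 : ∀ a b c : ZMod 2, a ≠ b → c ≠ a → c = b := by decide
            exact h3 _ _ _ htf ht'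
          rw [this]
          exact hf d
      · have := (h _ (hd (t - c d))).1
        simpa using this
    rw [Set.eq_univ_iff_forall] at h2 ⊢
    exact fun x => h2 x.1 x.2
  · push Not at hex
    refine absurd ⟨f, fun x => ?_, fun x => ?_⟩ hc
    · by_contra hne
      exact hex _ _ (Ne.symm hne) (h _ (hf x)).2
    · by_contra hne
      exact hex _ _ (Ne.symm hne) (h _ (hf x)).1

variable [Fintype α] [DecidableEq α]

lemma card_support_cycleOf_mem {ρ : Equiv.Perm α} {x : α} (hx : ρ x ≠ x) :
    (ρ.cycleOf x).support.card ∈ ρ.cycleType := by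
  rw [cycleType_def, Multiset.mem_map]
  exact ⟨_, cycleOf_mem_cycleFactorsFinset_iff.2 (mem_support.2 hx), rfl⟩

lemma pow_apply_eq_iff {ρ : Equiv.Perm α} {x : α} (hx : ρ x ≠ x) (n : ℕ) :
    (ρ ^ n) x = x ↔ (ρ.cycleOf x).support.card ∣ n := by
  have hc := isCycle_cycleOf ρ hx
  rw [← cycleOf_pow_apply_self, ← hc.pow_eq_one_iff' (by rwa [cycleOf_apply_self]), ← hc.orderOf,
    orderOf_dvd_iff_pow_eq_one]

lemma sameCycle_of_count_le_one {ρ : Equiv.Perm α} {x y : α} (hx : ρ x ≠ x) (hy : ρ y ≠ y)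
    (h : (ρ.cycleOf y).support.card = (ρ.cycleOf x).support.card)
    (hcount : ρ.cycleType.count (ρ.cycleOf x).support.card ≤ 1) : ρ.SameCycle x y := by
  have hx' := mem_support.2 hx
  have hy' := mem_support.2 hy
  rw [sameCycle_iff_cycleOf_eq_of_mem_support hx' hy']
  rw [cycleType_def, Multiset.count_map] at hcount
  have h2 : (ρ.cycleFactorsFinset.filter fun g =>
      (ρ.cycleOf x).support.card = g.support.card).card ≤ 1 := hcount
  rw [Finset.card_le_one] at h2
  exact h2 _ (Finset.mem_filter.2 ⟨cycleOf_mem_cycleFactorsFinset_iff.2 hx', rfl⟩) _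
    (Finset.mem_filter.2 ⟨cycleOf_mem_cycleFactorsFinset_iff.2 hy', h.symm⟩)

/-- The double cover of a torus map given by a cocycle. -/
def doubleCover {σ ρ : Equiv.Perm α} (hσ : ∀ x, σ (σ x) = x) (hσ' : ∀ x, σ x ≠ x)
    (face : ∀ x, σ (ρ (σ (ρ (σ (ρ x))))) = x) (hρ : ∀ x, ρ x ≠ x)
    (htr : ∀ B : Set α, B.Nonempty → (∀ x ∈ B, σ x ∈ B ∧ ρ x ∈ B) → B = Set.univ)
    (hdeg : ∀ k ∈ ρ.cycleType, k = 5 ∨ k = 6 ∨ k = 7)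
    (hcount : ∀ k ≠ 6, ρ.cycleType.count k ≤ 1) (hseven : 7 ∈ ρ.cycleType)
    {c : α → ZMod 2} (hc : ∀ x, c (σ x) = c x)
    (hface : ∀ x, c (ρ x) + c (ρ (σ (ρ x))) + c (ρ (σ (ρ (σ (ρ x))))) = 0)
    (hcob : ¬ ∃ f : α → ZMod 2, (∀ x, f (ρ x) = f x) ∧ ∀ x, f (σ x) = f x + c x) :
    DoubleMap (α × ZMod 2) where
  σ := liftFlip σ hσ c hc
  ρ := liftRotation ρ
  τ := Equiv.prodCongr (Equiv.refl _) (Equiv.addRight 1)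
  deg x := (ρ.cycleOf x.1).support.card
  σσ x := Prod.ext (hσ _) (by
    change x.2 + c x.1 + c (σ x.1) = x.2
    rw [hc, add_assoc, CharTwo.add_self_eq_zero, add_zero])
  face x := Prod.ext (face _) (by
    change x.2 + c (ρ x.1) + c (ρ (σ (ρ x.1))) + c (ρ (σ (ρ (σ (ρ x.1))))) = x.2
    have := hface x.1
    linear_combination this)
  στ x := Prod.ext rfl (add_right_comm _ _ _)
  ρτ x := rfl
  ττ x := Prod.ext rfl (by
    change x.2 + 1 + 1 = x.2
    rw [add_assoc, CharTwo.add_self_eq_zero, add_zero])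
  σ_ne x h := hσ' _ (congrArg Prod.fst h)
  σ_ne_τ x h := hσ' _ (congrArg Prod.fst h)
  not_sameCycle x h := by
    have h2 : x.2 = x.2 + 1 := (sameCycle_liftRotation.1 h).2
    simp at h2
  deg_mem x := hdeg _ (card_support_cycleOf_mem (hρ _))
  pow_deg x := by
    rw [liftRotation_pow, (pow_apply_eq_iff (hρ x.1) _).2 dvd_rfl]
  pow_ne x k h0 hk h := by
    rw [liftRotation_pow, Prod.ext_iff] at h
    exact absurd (Nat.le_of_dvd h0 ((pow_apply_eq_iff (hρ x.1) _).1 h.1)) (by omega)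
  deg_ρ x := by
    have : ρ.cycleOf (ρ x.1) = ρ.cycleOf x.1 := (SameCycle.refl ρ x.1).apply_left.cycleOf_eq
    exact congrArg (fun f => f.support.card) this
  deg_τ x := rfl
  uniq x y h6 h := by
    have hs := sameCycle_of_count_le_one (hρ x.1) (hρ y.1) h (hcount _ h6)
    have h3 : ∀ a b : ZMod 2, a = b ∨ a = b + 1 := by decide
    rcases h3 x.2 y.2 with h4 | h4
    · exact Or.inl (sameCycle_liftRotation.2 ⟨hs, h4⟩)
    · exact Or.inr (sameCycle_liftRotation.2 ⟨hs, h4⟩)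
  seven := by
    rw [cycleType_def, Multiset.mem_map] at hseven
    obtain ⟨g, hg, hg'⟩ := hseven
    obtain ⟨x, hx⟩ := (mem_cycleFactorsFinset_iff.1 hg).1.nonempty_support
    refine ⟨(x, 0), ?_⟩
    rw [← cycle_is_cycleOf hx hg]
    exact hg'
  conn A hA h := doubleCover_connected htr hcob hA h

end DoubleCover

lemma cycleType_of_fullCycleType {α : Type*} [Fintype α] [DecidableEq α] {σ : Equiv.Perm α}
    (h : 1 ∉ fullCycleType σ) : σ.cycleType = fullCycleType σ ∧ ∀ x, σ x ≠ x := by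
  have h0 : Fintype.card α - σ.cycleType.sum = 0 := by
    by_contra hne
    exact h (Multiset.mem_add.2 (Or.inr (Multiset.mem_replicate.2 ⟨hne, rfl⟩)))
  refine ⟨by rw [fullCycleType, h0, Multiset.replicate_zero, add_zero], fun x => ?_⟩
  rw [sum_cycleType] at h0
  have : σ.support = Finset.univ := by
    rw [← Finset.card_eq_iff_eq_univ]
    have := Finset.card_le_univ σ.support
    omega
  exact mem_support.1 (this ▸ Finset.mem_univ x)

lemma pow_eq_one_of_cycleType_eq_replicate {α : Type*} [Fintype α] [DecidableEq α]
    {σ : Equiv.Perm α} {a k : ℕ} (h : σ.cycleType = Multiset.replicate a k) : σ ^ k = 1 := by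
  rw [← orderOf_dvd_iff_pow_eq_one, ← lcm_cycleType, h, Multiset.lcm_dvd]
  exact fun b hb => (Multiset.eq_of_mem_replicate hb).dvd

lemma IsTransitiveSet.eq_univ {α : Type*} [Finite α] {s : Set (Equiv.Perm α)}
    (h : IsTransitiveSet s) {B : Set α} (hB : B.Nonempty) (hs : ∀ g ∈ s, ∀ x ∈ B, g x ∈ B) :
    B = Set.univ := by
  obtain ⟨x, hx⟩ := hB
  refine Set.eq_univ_iff_forall.2 fun y => ?_
  obtain ⟨g, hg, rfl⟩ := h x y
  have key : ∀ x ∈ B, g x ∈ B := by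
    induction hg using Subgroup.closure_induction with
    | mem g hg => exact hs g hg
    | one => exact fun x hx => hx
    | mul a b _ _ ha hb => exact fun x hx => ha _ (hb _ hx)
    | inv a _ ha => exact fun x hx => a.inv_apply_mem ha hx
  exact key x hx

end

/-- The genus-1 ramification type (D): [2^*][3^*][5,7,6^*] is not realizable in any degree. -/
theorem stmt9 (n : ℕ) (hn : 12 ≤ n) (h6 : 6 ∣ n) :
    ¬ Realizable n
      [Multiset.replicate (n / 2) 2,
        Multiset.replicate (n / 3) 3,
        5 ::ₘ 7 ::ₘ Multiset.replicate ((n - 12) / 6) 6] := by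
  rintro ⟨σs, hE, hprod, htr⟩
  obtain ⟨σ, φ, ψ, rfl⟩ : ∃ σ φ ψ, σs = [σ, φ, ψ] := by
    rw [← List.length_eq_three, ← List.length_map, hE]
    rfl
  simp only [List.map_cons, List.map_nil, List.cons.injEq, and_true] at hE
  obtain ⟨hσE, hφE, hψE⟩ := hE
  have hprod : σ * φ * ψ = 1 := by simpa [mul_assoc] using hprod
  obtain ⟨hσt, hσne⟩ := cycleType_of_fullCycleType (σ := σ) (by
    rw [hσE, Multiset.mem_replicate]; omega)
  obtain ⟨hφt, hφne⟩ := cycleType_of_fullCycleType (σ := φ) (by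
    rw [hφE, Multiset.mem_replicate]; omega)
  obtain ⟨hψt, hψne⟩ := cycleType_of_fullCycleType (σ := ψ) (by
    rw [hψE, Multiset.mem_cons, Multiset.mem_cons, Multiset.mem_replicate]; omega)
  rw [hσE] at hσt
  rw [hφE] at hφt
  rw [hψE] at hψt
  have hσ2 : ∀ x, σ (σ x) = x := fun x =>
    DFunLike.congr_fun (pow_eq_one_of_cycleType_eq_replicate hσt) x
  have hφ3 : ∀ x, φ (φ (φ x)) = x := fun x =>
    DFunLike.congr_fun (pow_eq_one_of_cycleType_eq_replicate hφt) x
  have hψ : ψ = (σ * φ)⁻¹ := eq_inv_of_mul_eq_one_right hprod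
  have hρt : (σ * φ).cycleType = 5 ::ₘ 7 ::ₘ Multiset.replicate ((n - 12) / 6) 6 := by
    rw [← hψt, hψ, Equiv.Perm.cycleType_inv]
  have hρne : ∀ x, (σ * φ) x ≠ x := fun x h => hψne x (by
    rw [hψ, Equiv.Perm.inv_eq_iff_eq, h])
  have hφρ : ∀ x, σ ((σ * φ) x) = φ x := fun x => hσ2 (φ x)
  have : Nonempty (Fin n) := ⟨⟨0, by omega⟩⟩
  obtain ⟨c, hcσ, hcφ, hcob⟩ := exists_cocycle (σ := σ) (ρ := σ * φ) (φ := φ) hσ2 hφ3 hφne hρne (by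
    rw [hφt, hρt, Fintype.card_fin]
    simp only [Multiset.card_replicate, Multiset.card_cons]
    omega)
  have htr' : ∀ B : Set (Fin n), B.Nonempty → (∀ x ∈ B, σ x ∈ B ∧ (σ * φ) x ∈ B) →
      B = Set.univ := fun B hB h => by
    refine htr.eq_univ hB fun g hg x hx => ?_
    simp only [Set.mem_ofPred_eq, List.mem_cons, List.not_mem_nil, or_false] at hg
    rcases hg with rfl | rfl | rfl
    · exact (h x hx).1
    · rw [← hφρ]
      exact (h _ (h x hx).2).1
    · rw [hψ]
      exact (σ * φ).inv_apply_mem (fun x hx => (h x hx).2) hx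
  refine DoubleMap.isEmpty.false (doubleCover hσ2 hσne (fun x => ?_) hρne htr' ?_ ?_ ?_ hcσ
    (fun x => ?_) hcob)
  · rw [hφρ, hφρ, hφρ, hφ3]
  · intro k hk
    rw [hρt, Multiset.mem_cons, Multiset.mem_cons, Multiset.mem_replicate] at hk
    omega
  · intro k hk
    rw [hρt, Multiset.count_cons, Multiset.count_cons, Multiset.count_replicate]
    split_ifs <;> omega
  · rw [hρt]
    simp
  · rw [hφρ, hφρ]
    exact hcφ x
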